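/- Let f(T_1,...,T_n,X) ∈ K[T_1,...,T_n,X] be an irreducible polynomial of positive degree in X. Let H_f(d) be the number of n-tuples (t_1,...,t_n) ∈ M_d^n such that f(t_1,...,t_n,X) ∈ K[X] is irreducible. Then there exists a constant C, depending only on f and q, such that |H_f(d)/q^{dn} − 1| ≤ C · d · q^{−d/2} for all d ≥ 1. -/

import Mathlib

namespace FunctionFieldHilbert

open Polynomial

section Counting

variable (F : Type*) [Field F] [Fintype F]

/-- The polynomials over `F` of degree less than `m`. -/
noncomputable def polysLT (m : ℕ) : Finset F[X] :=
  (Finset.univ : Finset (Fin m → F)).map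
    ((degreeLTEquiv F m).symm.toEquiv.toEmbedding.trans (Function.Embedding.subtype _))

/-- The monic polynomials over `F` of degree `d`. -/
noncomputable def monics (d : ℕ) : Finset F[X] :=
  (polysLT F d).map (addLeftEmbedding (X ^ d))

variable {F}

theorem mem_polysLT {m : ℕ} {p : F[X]} : p ∈ polysLT F m ↔ p.degree < m := by
  rw [← mem_degreeLT (R := F)]
  simp only [polysLT, Finset.mem_map, Finset.mem_univ, true_and]
  constructor
  · rintro ⟨c, rfl⟩
    exact ((degreeLTEquiv F m).symm c).2
  · intro h
    exact ⟨degreeLTEquiv F m ⟨p, h⟩, by simp⟩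

theorem card_polysLT (m : ℕ) : (polysLT F m).card = Fintype.card F ^ m := by
  simp [polysLT]

theorem mem_monics {d : ℕ} {p : F[X]} : p ∈ monics F d ↔ p.Monic ∧ p.natDegree = d := by
  simp only [monics, Finset.mem_map, mem_polysLT, addLeftEmbedding_apply]
  constructor
  · rintro ⟨r, hr, rfl⟩
    have h := monic_X_pow_add (n := d) (p := r) hr
    refine ⟨h, ?_⟩
    rw [natDegree_add_eq_left_of_degree_lt, natDegree_X_pow]
    rwa [degree_X_pow]
  · rintro ⟨h1, rfl⟩
    refine ⟨p - X ^ p.natDegree, ?_, by ring⟩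
    have hd : p.degree = (X ^ p.natDegree : F[X]).degree := by
      rw [degree_X_pow, degree_eq_natDegree h1.ne_zero]
    have := degree_sub_lt_left hd h1.ne_zero (by rw [h1.leadingCoeff, (monic_X_pow _).leadingCoeff])
    rwa [degree_eq_natDegree h1.ne_zero] at this

theorem card_monics (d : ℕ) : (monics F d).card = Fintype.card F ^ d := by
  simp [monics, card_polysLT]

theorem one_lt_card : 1 < Fintype.card F := Fintype.one_lt_card

/-- A residue class modulo a monic `v` contains at most `q ^ (d - deg v)` monics of degree `d`. -/
theorem card_residue_class_le [DecidableEq F[X]] {v : F[X]} (hv : v.Monic) (d : ℕ) (τ : F[X]) :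
    ((monics F d).filter (fun t => t %ₘ v = τ)).card ≤ Fintype.card F ^ (d - v.natDegree) := by
  rw [← card_monics]
  rcases lt_or_ge d v.natDegree with hd | hd
  · rw [card_monics, Nat.sub_eq_zero_of_le hd.le, pow_zero, Finset.card_le_one]
    have key : ∀ t ∈ (monics F d).filter (fun t => t %ₘ v = τ), t = τ := by
      intro t ht
      obtain ⟨ht, h⟩ := Finset.mem_filter.1 ht
      rw [mem_monics] at ht
      rw [← h, (modByMonic_eq_self_iff hv).2 (degree_lt_degree (by omega))]
    intro a ha b hb
    rw [key a ha, key b hb]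
  · refine Finset.card_le_card_of_injOn (fun t => t /ₘ v) ?_ ?_
    · intro t ht
      obtain ⟨ht, h⟩ := Finset.mem_filter.1 ht
      rw [mem_monics] at ht
      have hdeg : v.degree ≤ t.degree := by
        rw [degree_eq_natDegree hv.ne_zero, degree_eq_natDegree ht.1.ne_zero, ht.2]
        exact_mod_cast hd
      refine mem_monics.2 ⟨?_, by rw [natDegree_divByMonic t hv, ht.2]⟩
      rw [Monic, leadingCoeff_divByMonic_of_monic hv hdeg]
      exact ht.1
    · intro a ha b hb hab
      have h1 := (Finset.mem_filter.1 ha).2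
      have h2 := (Finset.mem_filter.1 hb).2
      rw [← modByMonic_add_div a v, ← modByMonic_add_div b v, h1, h2]
      simp only at hab
      rw [hab]

end Counting

section Primes

variable {F : Type*} [Field F] [Fintype F]

theorem exists_monic_irreducible {m : ℕ} (hm : m ≠ 0) :
    ∃ v : F[X], v.Monic ∧ Irreducible v ∧ v.natDegree = m := by
  obtain ⟨p, _⟩ := CharP.exists F
  have hp : Fact p.Prime := ⟨CharP.char_is_prime F p⟩
  have : NeZero m := ⟨hm⟩
  let E := FiniteField.Extension F p m
  have : Module.finrank F E = m := FiniteField.finrank_extension F p m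
  obtain ⟨α, hα⟩ := Field.exists_primitive_element F E
  have hint : IsIntegral F α := Algebra.IsIntegral.isIntegral α
  refine ⟨minpoly F α, minpoly.monic hint, minpoly.irreducible hint, ?_⟩
  rw [← IntermediateField.adjoin.finrank hint, hα, IntermediateField.finrank_top', this]

variable {B : Type*} [CommRing B] [IsDomain B] [UniqueFactorizationMonoid B] [Algebra F B]

omit [Fintype F] in
theorem prime_map_of_irreducible (ρ : B →ₐ[F] F) {v : F[X]} (hm : v.Monic) (hv : Irreducible v) :
    Prime (v.map (algebraMap F B)) := by
  refine Irreducible.prime (Monic.irreducible_of_irreducible_map (ρ : B →+* F) _ (hm.map _) ?_)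
  rw [Polynomial.map_map]
  have : (ρ : B →+* F).comp (algebraMap F B) = RingHom.id F := by
    ext x; simp
  rwa [this, Polynomial.map_id]

/-- A nonzero `δ` cannot be divisible by irreducible polynomials of too many degrees. -/
theorem exists_irreducible_not_dvd (ρ : B →ₐ[F] F) {δ : B[X]} (hδ : δ ≠ 0) {m₀ M : ℕ}
    (hm₀ : m₀ ≠ 0) (h : δ.natDegree < M * m₀) :
    ∃ v : F[X], v.Monic ∧ Irreducible v ∧ m₀ ≤ v.natDegree ∧ v.natDegree < m₀ + M ∧
      ¬ v.map (algebraMap F B) ∣ δ := by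
  by_contra! hcon
  choose v hv1 hv2 hv3 using fun i : ℕ =>
    exists_monic_irreducible (F := F) (m := m₀ + i) (by omega)
  set w : ℕ → B[X] := fun i => (v i).map (algebraMap F B) with hw
  have hwm : ∀ i, (w i).Monic := fun i => (hv1 i).map _
  have hwd : ∀ i, (w i).natDegree = m₀ + i := fun i => by
    rw [hw]; simp only; rw [(hv1 i).natDegree_map, hv3]
  have hcop : ∀ s : Finset ℕ, s ⊆ Finset.range M → (∏ i ∈ s, w i) ∣ δ := by
    intro s hs
    have hdvd : ∀ i ∈ s, w i ∣ δ := fun i hi => by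
      have := Finset.mem_range.1 (hs hi)
      exact hcon (v i) (hv1 i) (hv2 i) (by rw [hv3]; omega) (by rw [hv3]; omega)
    refine Finset.prod_dvd_of_isRelPrime ?_ hdvd
    intro i _ j _ hij
    refine (prime_map_of_irreducible ρ (hv1 i) (hv2 i)).irreducible.isRelPrime_iff_not_dvd.2 ?_
    intro hd
    have hassoc := ((prime_map_of_irreducible ρ (hv1 i) (hv2 i)).dvd_prime_iff_associated
      (prime_map_of_irreducible ρ (hv1 j) (hv2 j))).1 hd
    have := eq_of_monic_of_associated (hwm i) (hwm j) hassoc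
    have h1 := hwd i
    rw [this, hwd j] at h1
    omega
  have hd := natDegree_le_of_dvd (hcop _ subset_rfl) hδ
  rw [natDegree_prod_of_monic _ _ (fun i _ => hwm i)] at hd
  have : M * m₀ ≤ ∑ i ∈ Finset.range M, (w i).natDegree := by
    calc M * m₀ = ∑ i ∈ Finset.range M, m₀ := by simp
      _ ≤ _ := Finset.sum_le_sum fun i _ => by rw [hwd]; omega
  omega

end Primes

section Hensel

variable {O : Type*} [CommRing O]

theorem eval_scaleRoots_mul_add (h : O[X]) (x y z : O) :
    ∃ k, (scaleRoots h x).eval (x * y + z) =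
      x ^ h.natDegree * h.eval y + x ^ (h.natDegree - 1) * z * h.derivative.eval y + z ^ 2 * k := by
  let k : ℕ → O := fun i => (powAddExpansion (x * y) z i).1
  have hk : ∀ i, (x * y + z) ^ i = (x * y) ^ i + i * (x * y) ^ (i - 1) * z + k i * z ^ 2 :=
    fun i => (powAddExpansion (x * y) z i).2
  refine ⟨∑ i ∈ Finset.range (h.natDegree + 1), h.coeff i * x ^ (h.natDegree - i) * k i, ?_⟩
  have hder : h.derivative.eval y =
      ∑ i ∈ Finset.range (h.natDegree + 1), h.coeff i * i * y ^ (i - 1) := by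
    rw [derivative_eval, sum_over_range]
    simp
  rw [hder, eval_eq_sum_range, eval_eq_sum_range, natDegree_scaleRoots, Finset.mul_sum,
    Finset.mul_sum, Finset.mul_sum, ← Finset.sum_add_distrib, ← Finset.sum_add_distrib]
  refine Finset.sum_congr rfl fun i hi => ?_
  have hi : i ≤ h.natDegree := by simpa [Nat.lt_succ_iff] using hi
  rw [coeff_scaleRoots, hk i]
  obtain ⟨j, hj⟩ := Nat.exists_eq_add_of_le hi
  rcases Nat.eq_zero_or_pos i with rfl | hi0
  · simp; ring
  · obtain ⟨i, rfl⟩ := Nat.exists_eq_add_of_le' hi0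
    have h1 : h.natDegree - (i + 1) = j := by omega
    have h2 : h.natDegree - 1 = i + j := by omega
    rw [h1, h2, show h.natDegree = i + 1 + j from hj, Nat.add_sub_cancel]
    ring

theorem eval_eval_eq (G : O[X][X]) (P : O[X]) (t : O) :
    (G.eval P).eval t = (G.map (evalRingHom t)).eval (P.eval t) := by
  rw [eval_map]
  exact (eval₂_at_apply (evalRingHom t) P).symm

theorem dvd_eval_map_sub (G : O[X][X]) {v t t₀ y y₀ : O} (ht : v ∣ t - t₀) (hy : v ∣ y - y₀) :
    v ∣ (G.map (evalRingHom t)).eval y - (G.map (evalRingHom t₀)).eval y₀ := by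
  have h1 : ∀ s : O, (G.map (evalRingHom s)).eval y₀ = (G.eval (C y₀)).eval s := fun s => by
    rw [map_evalRingHom_eval, evalEval]
  have := dvd_add (hy.trans (sub_dvd_eval_sub y y₀ (G.map (evalRingHom t))))
    (ht.trans (sub_dvd_eval_sub t t₀ (G.eval (C y₀))))
  rwa [← h1 t, ← h1 t₀, sub_add_sub_cancel] at this

/-- Division-free Newton iteration: on a residue class of nonsingular points, the second coordinate
is, up to a power of the derivative, a polynomial in the first to any `v`-adic precision. -/
theorem exists_parametrization [Nontrivial O] {g : O[X][X]} (hg : g.Monic) (he : g.natDegree ≠ 0)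
    (v t₀ y₀ : O) (j : ℕ) :
    ∃ (N : ℕ) (P : O[X]), ∀ t y, v ∣ t - t₀ → v ∣ y - y₀ → (g.map (evalRingHom t)).eval y = 0 →
      v ^ (j + 1) ∣ (g.map (evalRingHom t₀)).derivative.eval y₀ ^ N * y - P.eval t := by
  induction j with
  | zero => exact ⟨0, C y₀, fun t y _ hy _ => by simpa using hy⟩
  | succ j ih =>
    obtain ⟨N, P, hP⟩ := ih
    set η := (g.map (evalRingHom t₀)).derivative.eval y₀ with hη
    set e := g.natDegree with he'
    set x := η ^ N with hx
    refine ⟨1 + N * e, C (η * x ^ (e - 1)) * P - (scaleRoots g (C x)).eval P, ?_⟩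
    intro t y ht hy h0
    have hz := hP t y ht hy h0
    have hgt : (g.map (evalRingHom t)).natDegree = e := hg.natDegree_map _
    obtain ⟨k, hk⟩ := eval_scaleRoots_mul_add (g.map (evalRingHom t)) x y
      (P.eval t - x * y)
    rw [h0, hgt, add_sub_cancel] at hk
    have hev : ((scaleRoots g (C x)).eval P).eval t =
        (scaleRoots (g.map (evalRingHom t)) x).eval (P.eval t) := by
      have h1 : scaleRoots (g.map (evalRingHom t)) x =
          (scaleRoots g (C x)).map (evalRingHom t) := by
        rw [map_scaleRoots _ _ _ (by rw [hg.leadingCoeff]; simp)]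
        simp
      rw [h1, eval_eval_eq]
    have hder : v ∣ (g.map (evalRingHom t)).derivative.eval y - η := by
      rw [hη, derivative_map, derivative_map]
      exact dvd_eval_map_sub _ ht hy
    have hvz : v ∣ P.eval t - x * y := by
      rw [dvd_sub_comm]
      exact (dvd_pow_self v (Nat.succ_ne_zero j)).trans hz
    have hprod : η ^ (1 + N * e) = η * x ^ (e - 1) * x := by
      rw [mul_assoc, ← pow_succ, Nat.sub_add_cancel (Nat.pos_of_ne_zero he), hx, ← pow_mul,
        pow_add, pow_one]
    have : η ^ (1 + N * e) * y - (C (η * x ^ (e - 1)) * P - (scaleRoots g (C x)).eval P).eval t =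
        (P.eval t - x * y) * (x ^ (e - 1) * ((g.map (evalRingHom t)).derivative.eval y - η) +
          (P.eval t - x * y) * k) := by
      rw [eval_sub, hev, hk, eval_mul, eval_C, hprod]
      ring
    rw [this, pow_succ]
    refine mul_dvd_mul ?_ (dvd_add (hder.mul_left _) (hvz.mul_right _))
    rwa [dvd_sub_comm]

end Hensel

section Siegel

variable {B : Type*} [CommRing B]

/-- The bivariate polynomial with coefficients `x`, where the coefficient of the `i`-th power of the
outer variable has `w i` free coefficients. -/
noncomputable def ofCoeffs {n : ℕ} (w : Fin n → ℕ) :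
    ((Σ i : Fin n, Fin (w i)) → B) →ₗ[B] B[X][X] :=
  Fintype.linearCombination B fun p => monomial (p.1 : ℕ) (monomial (p.2 : ℕ) (1 : B))

theorem coeff_coeff_ofCoeffs {n : ℕ} (w : Fin n → ℕ) (x : (Σ i : Fin n, Fin (w i)) → B) (i l : ℕ) :
    ((ofCoeffs w x).coeff i).coeff l =
      if h : ∃ h : i < n, l < w ⟨i, h⟩ then x ⟨⟨i, h.1⟩, ⟨l, h.2⟩⟩ else 0 := by
  have h1 : ((ofCoeffs w x).coeff i).coeff l =
      ∑ p : (Σ i : Fin n, Fin (w i)), if (p.1 : ℕ) = i ∧ (p.2 : ℕ) = l then x p else 0 := by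
    simp only [ofCoeffs, Fintype.linearCombination_apply, finsetSum_coeff, smul_monomial,
      coeff_monomial]
    refine Finset.sum_congr rfl fun p _ => ?_
    by_cases h1 : (p.1 : ℕ) = i <;> by_cases h2 : (p.2 : ℕ) = l <;> simp [h1, h2, coeff_monomial]
  rw [h1]
  split_ifs with h
  · rw [Finset.sum_eq_single ⟨⟨i, h.1⟩, ⟨l, h.2⟩⟩]
    · simp
    · rintro ⟨⟨a, ha⟩, ⟨b, hb⟩⟩ _ hne
      rw [if_neg]
      rintro ⟨h1, h2⟩
      simp only at h1 h2
      subst h1 h2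
      exact hne rfl
    · simp
  · refine Finset.sum_eq_zero fun p _ => if_neg ?_
    rintro ⟨rfl, rfl⟩
    exact h ⟨p.1.2, p.2.2⟩

/-- Siegel's lemma by counting dimensions. -/
theorem exists_auxiliary [IsDomain B] {v : B[X]} (hv : v.Monic) {A c d s : ℕ} (hcA : c ≤ A)
    (hcount : ∑ i ∈ Finset.range s, (s - i) * v.natDegree <
      ∑ i ∈ Finset.range (A + 1), ((A - i) * d + 1) +
        ∑ i ∈ Finset.range (A - c + 1), ((A - c - i) * d + 1))
    (t₀ η : B[X]) (P : B[X][X]) :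
    ∃ a b : B[X][X], (a ≠ 0 ∨ b ≠ 0) ∧
      (∀ i, a.coeff i ≠ 0 → (a.coeff i).natDegree + i * d ≤ A * d) ∧
      (∀ i, b.coeff i ≠ 0 → (b.coeff i).natDegree + (i + c) * d ≤ A * d) ∧
      ∀ i < s, v ^ (s - i) ∣ (taylor t₀ (C η * a + b * P)).coeff i := by
  let w₁ : Fin (A + 1) → ℕ := fun i => (A - i) * d + 1
  let w₂ : Fin (A - c + 1) → ℕ := fun i => (A - c - i) * d + 1
  let w₃ : Fin s → ℕ := fun i => (s - i) * v.natDegree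
  let I := (Σ i, Fin (w₁ i)) ⊕ (Σ i, Fin (w₂ i))
  let a : (I → B) →ₗ[B] B[X][X] := (ofCoeffs w₁) ∘ₗ LinearMap.funLeft B B Sum.inl
  let b : (I → B) →ₗ[B] B[X][X] := (ofCoeffs w₂) ∘ₗ LinearMap.funLeft B B Sum.inr
  let Ψ : (I → B) →ₗ[B] ((Σ i, Fin (w₃ i)) → B) :=
    { toFun := fun x p =>
        ((taylor t₀ (C η * a x + b x * P)).coeff p.1 %ₘ v ^ (s - p.1)).coeff p.2
      map_add' := fun x y => by
        funext p
        have : C η * a (x + y) + b (x + y) * P =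
          (C η * a x + b x * P) + (C η * a y + b y * P) := by
            rw [map_add, map_add]; ring
        simp only [this]
        rw [map_add, coeff_add, add_modByMonic, coeff_add]
        rfl
      map_smul' := fun r x => by
        funext p
        have : C η * a (r • x) + b (r • x) * P = C (C r) * (C η * a x + b x * P) := by
          rw [map_smul, map_smul, Algebra.smul_def, Algebra.smul_def,
            show algebraMap B B[X][X] r = C (C r) from rfl]
          ring
        simp only [this]
        rw [taylor_mul, taylor_C, coeff_C_mul, ← smul_eq_C_mul, smul_modByMonic, coeff_smul]
        rfl }
  have hninj : ¬ Function.Injective Ψ := by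
    intro hinj
    have := card_le_of_injective B Ψ hinj
    simp only [I, Fintype.card_sum, Fintype.card_sigma, Fintype.card_fin, w₁, w₂, w₃] at this
    rw [Fin.sum_univ_eq_sum_range (fun i => (A - i) * d + 1) (A + 1),
      Fin.sum_univ_eq_sum_range (fun i => (A - c - i) * d + 1) (A - c + 1),
      Fin.sum_univ_eq_sum_range (fun i => (s - i) * v.natDegree) s] at this
    omega
  obtain ⟨x, hx, hx0⟩ : ∃ x, Ψ x = 0 ∧ x ≠ 0 := by
    by_contra! h
    exact hninj ((injective_iff_map_eq_zero Ψ).2 h)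
  refine ⟨a x, b x, ?_, ?_, ?_, ?_⟩
  · by_contra! h
    apply hx0
    funext p
    rcases p with ⟨i, l⟩ | ⟨i, l⟩
    · have := coeff_coeff_ofCoeffs w₁ (x ∘ Sum.inl) i l
      rw [dif_pos ⟨i.2, l.2⟩] at this
      have h1 : ofCoeffs w₁ (x ∘ Sum.inl) = 0 := h.1
      rw [h1] at this
      simpa using this.symm
    · have := coeff_coeff_ofCoeffs w₂ (x ∘ Sum.inr) i l
      rw [dif_pos ⟨i.2, l.2⟩] at this
      have h1 : ofCoeffs w₂ (x ∘ Sum.inr) = 0 := h.2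
      rw [h1] at this
      simpa using this.symm
  · intro i hi
    have hc := coeff_coeff_ofCoeffs w₁ (x ∘ Sum.inl) i ((a x).coeff i).natDegree
    have h1 : ((ofCoeffs w₁ (x ∘ Sum.inl)).coeff i).coeff ((a x).coeff i).natDegree ≠ 0 :=
      leadingCoeff_ne_zero.2 hi
    split_ifs at hc with h
    · obtain ⟨h2, h3⟩ := h
      simp only [w₁] at h3
      obtain ⟨k, rfl⟩ := Nat.exists_eq_add_of_le (Nat.lt_succ_iff.1 h2)
      rw [Nat.add_sub_cancel_left] at h3
      linarith
    · exact absurd hc h1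
  · intro i hi
    have hc := coeff_coeff_ofCoeffs w₂ (x ∘ Sum.inr) i ((b x).coeff i).natDegree
    have h1 : ((ofCoeffs w₂ (x ∘ Sum.inr)).coeff i).coeff ((b x).coeff i).natDegree ≠ 0 :=
      leadingCoeff_ne_zero.2 hi
    split_ifs at hc with h
    · obtain ⟨h2, h3⟩ := h
      simp only [w₂] at h3
      obtain ⟨k, hk⟩ := Nat.exists_eq_add_of_le (Nat.lt_succ_iff.1 h2)
      obtain ⟨k', rfl⟩ := Nat.exists_eq_add_of_le hcA
      rw [Nat.add_sub_cancel_left] at hk h3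
      subst hk
      rw [Nat.add_sub_cancel_left] at h3
      linarith
    · exact absurd hc h1
  · intro i hi
    rw [← modByMonic_eq_zero_iff_dvd (hv.pow _)]
    ext l
    rw [coeff_zero]
    by_cases hl : l < (s - i) * v.natDegree
    · exact congrFun hx ⟨⟨i, hi⟩, ⟨l, hl⟩⟩
    · refine coeff_eq_zero_of_degree_lt ((degree_modByMonic_lt _ (hv.pow _)).trans_le ?_)
      rw [degree_eq_natDegree (hv.pow _).ne_zero, hv.natDegree_pow]
      exact_mod_cast not_lt.1 hl

end Siegel

section Degrees

variable {B : Type*} [CommRing B]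

theorem natDegree_eval_le {G : B[X][X]} {t : B[X]} {W d : ℕ} (ht : t.natDegree ≤ d)
    (hG : ∀ i, G.coeff i ≠ 0 → (G.coeff i).natDegree + i * d ≤ W) : (G.eval t).natDegree ≤ W := by
  rw [eval_eq_sum_range]
  refine natDegree_sum_le_of_forall_le _ _ fun i _ => ?_
  by_cases h : G.coeff i = 0
  · simp [h]
  · calc (G.coeff i * t ^ i).natDegree ≤ (G.coeff i).natDegree + (t ^ i).natDegree :=
          natDegree_mul_le
      _ ≤ (G.coeff i).natDegree + i * d := by
          gcongr
          exact natDegree_pow_le.trans (Nat.mul_le_mul_left i ht)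
      _ ≤ W := hG i h

theorem natDegree_eval_le' {G : B[X][X]} {t : B[X]} {D E d : ℕ} (ht : t.natDegree ≤ d)
    (hD : G.natDegree ≤ D) (hE : ∀ i, (G.coeff i).natDegree ≤ E * d) :
    (G.eval t).natDegree ≤ (E + D) * d := by
  refine natDegree_eval_le ht fun i hi => ?_
  have : i ≤ D := (le_natDegree_of_ne_zero hi).trans hD
  calc (G.coeff i).natDegree + i * d ≤ E * d + D * d := add_le_add (hE i) (by gcongr)
    _ = _ := by ring

theorem natDegree_root_le [IsDomain B] {h : B[X][X]} (hh : h.Monic) {W : ℕ}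
    (hW : ∀ i, (h.coeff i).natDegree ≤ W) {y : B[X]} (hy : h.eval y = 0) : y.natDegree ≤ W := by
  by_contra! hlt
  rw [hh.as_sum, eval_add, eval_pow, eval_X, eval_finsetSum] at hy
  have he : h.natDegree ≠ 0 := by
    intro h0
    rw [h0] at hy
    simp at hy
  have hy' : y ^ h.natDegree = - ∑ i ∈ Finset.range h.natDegree, eval y (C (h.coeff i) * X ^ i) :=
    eq_neg_of_add_eq_zero_left hy
  have h1 : (y ^ h.natDegree).natDegree ≤ W + (h.natDegree - 1) * y.natDegree := by
    rw [hy', natDegree_neg]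
    refine natDegree_sum_le_of_forall_le _ _ fun i hi => ?_
    rw [eval_mul, eval_C, eval_pow, eval_X]
    have hi : i ≤ h.natDegree - 1 := by
      have := Finset.mem_range.1 hi
      omega
    calc _ ≤ (h.coeff i).natDegree + (y ^ i).natDegree := natDegree_mul_le
      _ ≤ W + i * y.natDegree := add_le_add (hW i) natDegree_pow_le
      _ ≤ _ := by gcongr
  rw [natDegree_pow] at h1
  obtain ⟨k, hk⟩ := Nat.exists_eq_succ_of_ne_zero he
  rw [hk, Nat.succ_sub_one, Nat.succ_mul] at h1
  omega

end Degrees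

section ClassBound

variable {B : Type*} [CommRing B] [IsDomain B] [UniqueFactorizationMonoid B]

/-- The numerator of `g (-a / b)`. -/
theorem scaleRoots_eval_ne_zero {g : B[X][X][X]} (hg : g.Monic) (hroot : ∀ r, g.eval r ≠ 0)
    {a b : B[X][X]} (hab : a ≠ 0 ∨ b ≠ 0) : (scaleRoots g b).eval (-a) ≠ 0 := by
  by_cases hb : b = 0
  · subst hb
    have ha : a ≠ 0 := by simpa using hab
    rw [scaleRoots_zero, hg.leadingCoeff, one_smul, eval_pow, eval_X]
    exact pow_ne_zero _ (neg_ne_zero.2 ha)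
  · intro h
    let K := FractionRing B[X][X]
    have hb' : algebraMap B[X][X] K b ≠ 0 := by
      simpa using hb
    have h1 := scaleRoots_eval₂_mul (p := g) (algebraMap B[X][X] K)
      (algebraMap B[X][X] K (-a) / algebraMap B[X][X] K b) b
    rw [mul_div_cancel₀ _ hb', eval₂_at_apply, h, map_zero] at h1
    have h2 : aeval (algebraMap B[X][X] K (-a) / algebraMap B[X][X] K b) g = 0 := by
      rcases mul_eq_zero.1 h1.symm with h | h
      · exact absurd h (pow_ne_zero _ hb')
      · exact h
    obtain ⟨r, hr⟩ := isInteger_of_is_root_of_monic hg h2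
    rw [← hr, aeval_algebraMap_apply, aeval_def, Algebra.algebraMap_self, eval₂_id] at h2
    exact hroot r ((map_eq_zero_iff _ (IsFractionRing.injective B[X][X] K)).1 h2)

omit [IsDomain B] [UniqueFactorizationMonoid B] in
theorem natDegree_scaleRoots_eval_le {g : B[X][X][X]} {D A : ℕ}
    (hD : ∀ i, (g.coeff i).natDegree ≤ D) {a b : B[X][X]} (ha : a.natDegree ≤ A)
    (hb : b.natDegree ≤ A) :
    ((scaleRoots g b).eval (-a)).natDegree ≤ g.natDegree * A + D := by
  rw [eval_eq_sum_range, natDegree_scaleRoots]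
  refine natDegree_sum_le_of_forall_le _ _ fun i hi => ?_
  have hi : i ≤ g.natDegree := by simpa [Nat.lt_succ_iff] using hi
  rw [coeff_scaleRoots]
  calc _ ≤ (g.coeff i * b ^ (g.natDegree - i)).natDegree + ((-a) ^ i).natDegree := natDegree_mul_le
    _ ≤ (g.coeff i).natDegree + (b ^ (g.natDegree - i)).natDegree + ((-a) ^ i).natDegree := by
        gcongr
        exact natDegree_mul_le
    _ ≤ D + (g.natDegree - i) * A + i * A := by
        gcongr
        · exact hD i
        · exact natDegree_pow_le.trans (by gcongr)
        · exact natDegree_pow_le.trans (by rw [natDegree_neg]; gcongr)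
    _ = g.natDegree * A + D := by
        obtain ⟨k, hk⟩ := Nat.exists_eq_add_of_le hi
        rw [hk, Nat.add_sub_cancel_left]
        ring

theorem sum_range_tsub_mul (s m : ℕ) : 2 * ∑ i ∈ Finset.range s, (s - i) * m = s * (s + 1) * m := by
  induction s with
  | zero => simp
  | succ s ih =>
    rw [Finset.sum_range_succ', mul_add]
    have : ∑ i ∈ Finset.range s, (s + 1 - (i + 1)) * m = ∑ i ∈ Finset.range s, (s - i) * m :=
      Finset.sum_congr rfl fun i _ => by rw [Nat.add_sub_add_right]
    rw [this, ih]
    simp only [Nat.sub_zero]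
    ring

theorem siegel_count {c d m : ℕ} (hd : 1 ≤ d) (hm : d + 1 ≤ 2 * m) :
    ∑ i ∈ Finset.range ((5 + 2 * c) * d + 1), ((5 + 2 * c) * d + 1 - i) * m <
      ∑ i ∈ Finset.range ((5 + 2 * c) * m + 1), (((5 + 2 * c) * m - i) * d + 1) +
        ∑ i ∈ Finset.range ((5 + 2 * c) * m - c + 1), (((5 + 2 * c) * m - c - i) * d + 1) := by
  have hgauss : ∀ A : ℕ, 2 * ∑ i ∈ Finset.range (A + 1), ((A - i) * d + 1) =
      A * (A + 1) * d + 2 * (A + 1) := by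
    intro A
    rw [Finset.sum_add_distrib, Finset.sum_range_succ, mul_add, mul_add, sum_range_tsub_mul]
    simp
  have h1 := sum_range_tsub_mul ((5 + 2 * c) * d + 1) m
  have h2 := hgauss ((5 + 2 * c) * m)
  have h3 := hgauss ((5 + 2 * c) * m - c)
  obtain ⟨A', hA'⟩ : ∃ A', (5 + 2 * c) * m = A' + c :=
    ⟨(5 + 2 * c) * m - c, by rw [Nat.sub_add_cancel]; nlinarith⟩
  have key : ((5 + 2 * c) * d + 1) * ((5 + 2 * c) * d + 1 + 1) * m <
      (5 + 2 * c) * m * ((5 + 2 * c) * m + 1) * d + 2 * ((5 + 2 * c) * m + 1) +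
      (A' * (A' + 1) * d + 2 * (A' + 1)) := by
    obtain ⟨e, he⟩ := Nat.exists_eq_add_of_le hm
    zify at hA' he ⊢
    have hA'' : (A' : ℤ) = (5 + 2 * c) * m - c := by linarith
    have hm1 : (1 : ℤ) ≤ m := by omega
    have hd1 : (1 : ℤ) ≤ d := by omega
    have hc0 : (0 : ℤ) ≤ c := by positivity
    have he0 : (0 : ℤ) ≤ (5 + 2 * c) ^ 2 * m * d * e := by positivity
    have h1 : (0 : ℤ) ≤ c * d * (m - 1) := mul_nonneg (by positivity) (by linarith)
    have h2 : (0 : ℤ) ≤ c * (m - 1) := mul_nonneg hc0 (by linarith)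
    have h3 : (0 : ℤ) ≤ c ^ 2 * d := by positivity
    have h4 : (0 : ℤ) ≤ c * m * d := by positivity
    have h5 : (0 : ℤ) ≤ m * d := by positivity
    have h6 : ((5 + 2 * c) * m * ((5 + 2 * c) * m + 1) * d + 2 * ((5 + 2 * c) * m + 1) +
        (A' * (A' + 1) * d + 2 * (A' + 1)) : ℤ) -
        ((5 + 2 * c) * d + 1) * ((5 + 2 * c) * d + 1 + 1) * m =
        (5 + 2 * c) ^ 2 * m * d * e + 20 * (m * d) + 7 * (c * m * d) + c * d * (m - 1) + c ^ 2 * d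
        + 18 * m + 6 * (c * m) + 2 * (c * (m - 1)) + 4 := by
      have : (e : ℤ) = 2 * m - d - 1 := by linarith
      rw [hA'', this]
      ring
    have h7 : (0 : ℤ) ≤ c * m := by positivity
    linarith
  rw [show (5 + 2 * c) * m - c = A' by omega] at h3 ⊢
  omega

/-- The points with first coordinate of degree at most `d` in a nonsingular residue class modulo
a prime `v` of degree greater than `d / 2` are few. -/
theorem card_class_le {v : B[X]} (hv : v.Monic) (hvp : Prime v) {g : B[X][X][X]} (hg : g.Monic)
    (hroot : ∀ r, g.eval r ≠ 0) {c d D : ℕ} (hd : 1 ≤ d)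
    (hm : d + 1 ≤ 2 * v.natDegree) (hD : ∀ i, (g.coeff i).natDegree ≤ D) {t₀ y₀ : B[X]}
    (hη : ¬ v ∣ (g.map (evalRingHom t₀)).derivative.eval y₀) (S : Finset B[X])
    (hS : ∀ t ∈ S, t.natDegree ≤ d ∧ v ∣ t - t₀ ∧
      ∃ y, y.natDegree ≤ c * d ∧ v ∣ y - y₀ ∧ (g.map (evalRingHom t)).eval y = 0) :
    S.card ≤ g.natDegree * ((5 + 2 * c) * v.natDegree) + D := by
  have he : g.natDegree ≠ 0 := by
    intro h0
    rw [hg.natDegree_eq_zero] at h0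
    rw [h0] at hη
    simp at hη
  set m := v.natDegree with hm_def
  set A := (5 + 2 * c) * m with hA
  set s := (5 + 2 * c) * d + 1 with hs
  obtain ⟨N, P, hP⟩ := exists_parametrization hg he v t₀ y₀ (s - 1)
  set η := (g.map (evalRingHom t₀)).derivative.eval y₀ with hη_def
  have hcA : c ≤ A := by rw [hA]; nlinarith
  obtain ⟨a, b, hab, ha, hb, hQ⟩ := exists_auxiliary hv (A := A) (c := c) (d := d) (s := s) hcA
    (siegel_count hd hm) t₀ (η ^ N) P
  have hvanish : ∀ t ∈ S, ((scaleRoots g b).eval (-a)).eval t = 0 := by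
    intro t ht
    obtain ⟨htd, htv, y, hyd, hyv, hy⟩ := hS t ht
    have hlin : a.eval t + b.eval t * y = 0 := by
      by_contra hne
      have hdvd : v ^ s ∣ a.eval t + b.eval t * y := by
        suffices h : v ^ s ∣ η ^ N * (a.eval t + b.eval t * y) from
          hvp.pow_dvd_of_dvd_mul_left s (fun h => hη (hvp.dvd_of_dvd_pow h)) h
        have h1 : v ^ s ∣ (C (η ^ N) * a + b * P).eval t := by
          have h2 := taylor_eval t₀ (C (η ^ N) * a + b * P) (t - t₀)
          rw [sub_add_cancel] at h2
          rw [← h2, eval_eq_sum_range]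
          refine Finset.dvd_sum fun i _ => ?_
          rcases lt_or_ge i s with hi | hi
          · have := mul_dvd_mul (hQ i hi) (pow_dvd_pow_of_dvd htv i)
            rwa [← pow_add, Nat.sub_add_cancel hi.le] at this
          · exact ((pow_dvd_pow v hi).trans (pow_dvd_pow_of_dvd htv i)).mul_left _
        have h3 := hP t y htv hyv hy
        rw [show s - 1 + 1 = s by omega] at h3
        have h4 := dvd_add h1 (h3.mul_left (b.eval t))
        simp only [eval_add, eval_mul, eval_C] at h4
        convert h4 using 1
        ring
      have hdeg := natDegree_le_of_dvd hdvd hne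
      rw [hv.natDegree_pow, ← hm_def] at hdeg
      have h5 : (a.eval t + b.eval t * y).natDegree ≤ A * d := by
        refine (natDegree_add_le _ _).trans (max_le (natDegree_eval_le htd ha) ?_)
        by_cases hb0 : b = 0
        · simp [hb0]
        have h6 : c * d ≤ A * d := by gcongr
        have h7 : (b.eval t).natDegree ≤ A * d - c * d := natDegree_eval_le htd fun i hi => by
          have := hb i hi
          rw [add_mul] at this
          omega
        exact natDegree_mul_le.trans (by omega)
      have h8 : s * m = A * d + m := by rw [hs, hA]; ring
      omega
    rw [eval_eval_eq, map_scaleRoots _ _ _ (by rw [hg.leadingCoeff]; simp)]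
    have h1 := scaleRoots_eval₂_mul (p := g.map (evalRingHom t)) (RingHom.id _) y (b.eval t)
    have hby : b.eval t * y = -(a.eval t) := eq_neg_of_add_eq_zero_right hlin
    rw [RingHom.id_apply, hby, eval₂_id, eval₂_id, hy, mul_zero] at h1
    rw [eval_neg]
    exact h1
  have hdegA : ∀ p : B[X][X], (∀ i, p.coeff i ≠ 0 → i * d ≤ A * d) → p.natDegree ≤ A := by
    intro p hp
    rw [natDegree_le_iff_coeff_eq_zero]
    intro i hi
    by_contra h
    have := Nat.le_of_mul_le_mul_right (hp i h) hd
    omega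
  refine (card_le_degree_of_subset_roots (p := (scaleRoots g b).eval (-a)) ?_).trans
    (natDegree_scaleRoots_eval_le hD (hdegA a fun i hi => ?_) (hdegA b fun i hi => ?_))
  · intro t ht
    exact (mem_roots (scaleRoots_eval_ne_zero hg hroot hab)).2 (hvanish t ht)
  · have := ha i hi
    omega
  · have := hb i hi
    rw [add_mul] at this
    omega

end ClassBound

section Sieve

variable {F : Type*} [Field F] [Fintype F] {B : Type*} [CommRing B] [IsDomain B]
  [UniqueFactorizationMonoid B] [Algebra F B]

/-- If each residue class modulo primes of degree about `d / 2` on which `Δ` does not vanish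
contains at most `H` elements of `S`, then `S` has about `H * q ^ (d / 2)` elements. -/
theorem card_mul_le_of_classes (ρ : B →ₐ[F] F) {Δ : B[X][X]} (hΔ : Δ ≠ 0) {D E d H : ℕ}
    (hd : 1 ≤ d) (hD : Δ.natDegree ≤ D) (hE : ∀ i, (Δ.coeff i).natDegree ≤ E * d)
    {S : Finset F[X]} (hS : S ⊆ monics F d)
    (hH : ∀ v : F[X], v.Monic → Irreducible v → d + 1 ≤ 2 * v.natDegree →
      v.natDegree ≤ d / 2 + 1 + 2 * E → ∀ τ : F[X],
      ¬ v.map (algebraMap F B) ∣ Δ.eval (τ.map (algebraMap F B)) →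
      ∀ S' ⊆ S, (∀ t ∈ S', v ∣ t - τ) → S'.card ≤ H) :
    S.card * Fintype.card F ^ (d / 2) ≤
      (Fintype.card F ^ (2 * E + 1) * H + D) * Fintype.card F ^ d := by
  classical
  have hq := one_lt_card (F := F)
  set q := Fintype.card F
  obtain ⟨i, hi⟩ : ∃ i, Δ.coeff i ≠ 0 := by
    by_contra! h
    exact hΔ (Polynomial.ext fun i => by simpa using h i)
  obtain ⟨v, hv, hvi, hm1, hm2, hvd⟩ := exists_irreducible_not_dvd ρ hi (m₀ := d / 2 + 1)
    (M := 2 * E + 1) (by omega) ((hE i).trans_lt (by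
      have : d + 1 ≤ 2 * (d / 2 + 1) := by omega
      nlinarith))
  set m := v.natDegree with hm
  set ι := algebraMap F B
  have hι : Function.Injective ι := ι.injective
  set w := v.map ι with hw
  have hwp : Prime w := prime_map_of_irreducible ρ hv hvi
  set good := S.filter (fun t => ¬ w ∣ Δ.eval (t.map ι)) with hgood
  set bad := S.filter (fun t => w ∣ Δ.eval (t.map ι)) with hbad
  have hcard : S.card = bad.card + good.card := (Finset.card_filter_add_card_filter_not _).symm
  have hG : good.card ≤ H * q ^ m := by
    rw [← card_polysLT]
    refine Finset.card_le_mul_card_image_of_maps_to (f := fun t => t %ₘ v) ?_ H ?_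
    · intro t _
      refine mem_polysLT.2 ?_
      rw [hm, ← degree_eq_natDegree hv.ne_zero]
      exact degree_modByMonic_lt _ hv
    · intro τ _
      rcases ((good.filter (fun t => t %ₘ v = τ))).eq_empty_or_nonempty with h | ⟨s, hs⟩
      · simp [h]
      obtain ⟨hs1, hs2⟩ := Finset.mem_filter.1 hs
      refine hH v hv hvi (by omega) (by omega) s (Finset.mem_filter.1 hs1).2 _
        ((Finset.filter_subset _ _).trans (Finset.filter_subset _ _)) fun t ht => ?_
      rw [← modByMonic_eq_zero_iff_dvd hv, sub_modByMonic, (Finset.mem_filter.1 ht).2, hs2,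
        sub_self]
  have hB : bad.card ≤ D * q ^ (d - m) := by
    let Q := B[X] ⧸ Ideal.span {w}
    have : (Ideal.span {w}).IsPrime := (Ideal.span_singleton_prime hwp.ne_zero).2 hwp
    let mk : B[X] →+* Q := Ideal.Quotient.mk _
    have hmk : ∀ x, mk x = 0 ↔ w ∣ x := fun x => by
      rw [← Ideal.mem_span_singleton]
      exact Ideal.Quotient.eq_zero_iff_mem
    have hΔ' : Δ.map mk ≠ 0 := by
      intro h
      have := congrArg (fun p => coeff p i) h
      rw [coeff_map, coeff_zero, hmk] at this
      exact hvd this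
    have hroots : (bad.image (fun t => mk (t.map ι))).card ≤ D := by
      refine (card_le_degree_of_subset_roots (p := Δ.map mk) ?_).trans (natDegree_map_le.trans hD)
      intro x hx
      obtain ⟨t, ht, rfl⟩ := Finset.mem_image.1 (Finset.mem_def.2 hx)
      rw [mem_roots hΔ', IsRoot, eval_map_apply, hmk]
      exact (Finset.mem_filter.1 ht).2
    refine (Finset.card_le_mul_card_image (f := fun t => mk (t.map ι)) bad (q ^ (d - m)) ?_).trans
      (by rw [mul_comm]; gcongr)
    intro x hx
    obtain ⟨s, hs, rfl⟩ := Finset.mem_image.1 hx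
    refine (Finset.card_le_card ?_).trans (card_residue_class_le hv d (s %ₘ v))
    intro t ht
    obtain ⟨ht1, ht2⟩ := Finset.mem_filter.1 ht
    refine Finset.mem_filter.2 ⟨hS (Finset.mem_filter.1 ht1).1, ?_⟩
    rw [← sub_eq_zero, ← sub_modByMonic, modByMonic_eq_zero_iff_dvd hv, ← map_dvd_map ι hι hv,
      Polynomial.map_sub, ← hmk, map_sub, ht2, sub_self]
  have h1 : q ^ m ≤ q ^ (2 * E + 1) * q ^ (d / 2) := by
    rw [← pow_add]
    exact Nat.pow_le_pow_right hq.le (by omega)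
  have h2 : q ^ (d - m) * q ^ (d / 2) ≤ q ^ d := by
    rw [← pow_add]
    exact Nat.pow_le_pow_right hq.le (by omega)
  have h3 : q ^ (d / 2) * q ^ (d / 2) ≤ q ^ d := by
    rw [← pow_add]
    exact Nat.pow_le_pow_right hq.le (by omega)
  calc S.card * q ^ (d / 2)
      ≤ (D * q ^ (d - m) + H * (q ^ (2 * E + 1) * q ^ (d / 2))) * q ^ (d / 2) := by
        rw [hcard]
        gcongr
        exact hG.trans (by gcongr)
    _ = D * (q ^ (d - m) * q ^ (d / 2)) + H * q ^ (2 * E + 1) * (q ^ (d / 2) * q ^ (d / 2)) := by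
        ring
    _ ≤ D * q ^ d + H * q ^ (2 * E + 1) * q ^ d := by gcongr
    _ = _ := by ring

/-- A monic separable `g` with no root in `B[u][T]` has a root in `B[u]` for few
specializations `T ↦ t`. -/
theorem exists_card_root_le (ρ : B →ₐ[F] F) (e D E : ℕ) : ∃ K : ℕ, ∀ d, 1 ≤ d →
    ∀ g α β : B[X][X][X], ∀ Δ : B[X][X], g.Monic → g.natDegree ≤ e →
    (∀ i, (g.coeff i).natDegree ≤ D) → (∀ i j, ((g.coeff i).coeff j).natDegree ≤ E * d) →
    (∀ r, g.eval r ≠ 0) → α * g + β * derivative g = C Δ → Δ ≠ 0 → Δ.natDegree ≤ D →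
    (∀ j, (Δ.coeff j).natDegree ≤ E * d) → ∀ S ⊆ monics F d,
    (∀ t ∈ S, ∃ y, (g.map (evalRingHom (t.map (algebraMap F B)))).eval y = 0) →
    S.card * Fintype.card F ^ (d / 2) ≤ K * d * Fintype.card F ^ d := by
  classical
  set H := e * (e * ((5 + 2 * (E + D)) * (2 + 2 * E)) + D) with hH
  refine ⟨Fintype.card F ^ (2 * E + 1) * H + D, ?_⟩
  intro d hd g α β Δ hg hge hgD hgE hroot hab hΔ hΔD hΔE S hS hroots
  suffices h : S.card * Fintype.card F ^ (d / 2) ≤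
      (Fintype.card F ^ (2 * E + 1) * (H * d) + D) * Fintype.card F ^ d by
    refine h.trans (Nat.mul_le_mul_right _ ?_)
    have : D * 1 ≤ D * d := by gcongr
    rw [add_mul, ← mul_assoc]
    exact add_le_add_right (by simpa using this) _
  refine card_mul_le_of_classes ρ hΔ hd hΔD hΔE hS ?_
  intro v hv hvi hm1 hm2 τ hτ S' hS' hS'v
  set ι := algebraMap F B
  have hι : Function.Injective ι := ι.injective
  set w := v.map ι with hw
  have hwm : w.Monic := hv.map _
  have hwd : w.natDegree = v.natDegree := hv.natDegree_map _
  have hwp : Prime w := prime_map_of_irreducible ρ hv hvi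
  have hy' : ∀ t : F[X], ∃ y, t ∈ S' → (g.map (evalRingHom (t.map ι))).eval y = 0 := by
    intro t
    by_cases ht : t ∈ S'
    · obtain ⟨y, hy⟩ := hroots t (hS' ht)
      exact ⟨y, fun _ => hy⟩
    · exact ⟨0, fun h => absurd h ht⟩
  choose y hy using hy'
  have hdvd : ∀ t ∈ S', w ∣ t.map ι - τ.map ι := fun t ht => by
    rw [← Polynomial.map_sub]
    exact (map_dvd_map ι hι hv).2 (hS'v t ht)
  let Q := B[X] ⧸ Ideal.span {w}
  have : (Ideal.span {w}).IsPrime := (Ideal.span_singleton_prime hwp.ne_zero).2 hwp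
  let mk : B[X] →+* Q := Ideal.Quotient.mk _
  have hmk : ∀ x, mk x = 0 ↔ w ∣ x := fun x => by
    rw [← Ideal.mem_span_singleton]
    exact Ideal.Quotient.eq_zero_iff_mem
  have hτy : ∀ t ∈ S', w ∣ (g.map (evalRingHom (τ.map ι))).eval (y t) := fun t ht => by
    have := dvd_eval_map_sub g (hdvd t ht) (show w ∣ y t - y t by simp)
    rw [hy t ht, zero_sub, dvd_neg] at this
    exact this
  set p := (g.map (evalRingHom (τ.map ι))).map mk with hp
  have hpm : p.Monic := (hg.map _).map _
  have hcl : (S'.image (fun t => mk (y t))).card ≤ e := by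
    refine (card_le_degree_of_subset_roots (p := p) ?_).trans
      (natDegree_map_le.trans (natDegree_map_le.trans hge))
    intro x hx
    obtain ⟨t, ht, rfl⟩ := Finset.mem_image.1 (Finset.mem_def.2 hx)
    rw [mem_roots hpm.ne_zero, IsRoot, hp, eval_map_apply, hmk]
    exact hτy t ht
  have hmd : v.natDegree ≤ (2 + 2 * E) * d := by
    have : 2 * E * 1 ≤ 2 * E * d := by gcongr
    rw [add_mul]
    omega
  refine (Finset.card_le_mul_card_image (f := fun t => mk (y t)) S'
    ((e * ((5 + 2 * (E + D)) * (2 + 2 * E)) + D) * d) ?_).trans ?_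
  · intro x hx
    obtain ⟨s, hs, rfl⟩ := Finset.mem_image.1 hx
    rw [← Finset.card_image_of_injective _ (map_injective ι hι)]
    refine (card_class_le hwm hwp hg hroot hd (c := E + D) (t₀ := τ.map ι) (y₀ := y s)
      (by omega) hgD ?_ _ ?_).trans ?_
    · intro h
      refine hτ ?_
      have h1 := congrArg (fun f => (f.map (evalRingHom (τ.map ι))).eval (y s)) hab
      simp only [Polynomial.map_add, Polynomial.map_mul, eval_add, eval_mul, map_C, eval_C,
        ← derivative_map, coe_evalRingHom] at h1
      rw [← h1]
      exact dvd_add ((hτy s hs).mul_left _) (h.mul_left _)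
    · intro t' ht'
      obtain ⟨t, ht, rfl⟩ := Finset.mem_image.1 ht'
      obtain ⟨ht1, ht2⟩ := Finset.mem_filter.1 ht
      have htd : (t.map ι).natDegree ≤ d :=
        natDegree_map_le.trans (mem_monics.1 (hS (hS' ht1))).2.le
      refine ⟨htd, hdvd t ht1, y t, ?_, ?_, hy t ht1⟩
      · refine natDegree_root_le (hg.map (evalRingHom (t.map ι))) (fun i => ?_) (hy t ht1)
        rw [coeff_map]
        exact natDegree_eval_le' htd (hgD i) (hgE i)
      · rw [← hmk, map_sub, ht2, sub_self]
    · rw [hwd]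
      calc _ ≤ e * ((5 + 2 * (E + D)) * ((2 + 2 * E) * d)) + D * d := by
            gcongr
            exact Nat.le_mul_of_pos_right _ hd
        _ = _ := by ring
  · calc _ ≤ (e * ((5 + 2 * (E + D)) * (2 + 2 * E)) + D) * d * e := by gcongr
      _ = _ := by rw [hH]; ring

/-- A polynomial with nonzero `T`-derivative has few specializations with zero derivative. -/
theorem exists_card_derivative_eq_zero_le (F : Type*) [Field F] [Fintype F] (D E : ℕ) :
    ∃ K : ℕ, ∀ d, 1 ≤ d → ∀ b : F[X][X], derivative b ≠ 0 → b.natDegree ≤ D →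
    (∀ j, (b.coeff j).natDegree ≤ E * d) → ∀ S ⊆ monics F d,
    (∀ t ∈ S, derivative (b.eval t) = 0) →
    S.card * Fintype.card F ^ (d / 2) ≤ K * d * Fintype.card F ^ d := by
  refine ⟨Fintype.card F ^ (2 * E + 1) * 1 + D, ?_⟩
  intro d hd b hb hbD hbE S hS hder
  suffices h : S.card * Fintype.card F ^ (d / 2) ≤
      (Fintype.card F ^ (2 * E + 1) * 1 + D) * Fintype.card F ^ d from
    h.trans (Nat.mul_le_mul_right _ (Nat.le_mul_of_pos_right _ hd))
  refine card_mul_le_of_classes (AlgHom.id F F) hb hd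
    ((natDegree_derivative_le b).trans ((Nat.sub_le _ _).trans hbD)) (fun i => ?_) hS ?_
  · rw [coeff_derivative]
    refine natDegree_mul_le.trans ?_
    have : ((i : F[X]) + 1).natDegree = 0 := by exact_mod_cast natDegree_natCast (R := F) (i + 1)
    rw [this]
    exact hbE _
  intro v hv hvi hm1 hm2 τ hτ S' hS' hS'v
  have hvp : Prime v := hvi.prime
  simp only [Algebra.algebraMap_self, Polynomial.map_id] at hτ
  rw [Finset.card_le_one]
  intro t ht s hs
  obtain ⟨w, hw⟩ : v ∣ t - s := by
    have := dvd_sub (hS'v t ht) (hS'v s hs)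
    rwa [sub_sub_sub_cancel_right] at this
  obtain ⟨k, hk⟩ := b.binomExpansion s (v * w)
  have ht' : s + v * w = t := by rw [← hw]; ring
  rw [ht', pow_two] at hk
  have h1 := congrArg derivative hk
  rw [hder t (hS' ht), derivative_add, derivative_add, hder s (hS' hs)] at h1
  simp only [derivative_mul] at h1
  have h2 : v ∣ (derivative b).eval s * derivative v * w := by
    refine ⟨-(derivative ((derivative b).eval s) * w + (derivative b).eval s * derivative w +
      derivative k * v * w ^ 2 + k * 2 * w * (derivative v * w + v * derivative w)), ?_⟩
    linear_combination -h1
  have hbs : ¬ v ∣ (derivative b).eval s := fun h => by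
    have := dvd_sub h ((hS'v s hs).trans (sub_dvd_eval_sub s τ (derivative b)))
    rw [sub_sub_cancel] at this
    exact hτ this
  have hv' : ¬ v ∣ derivative v := fun h => by
    have hsep : v.Separable := PerfectField.separable_of_irreducible hvi
    exact hvi.not_isUnit (hsep.isUnit_of_dvd' dvd_rfl h)
  have hvw : v ∣ w := by
    rcases hvp.dvd_or_dvd h2 with h | h
    · rcases hvp.dvd_or_dvd h with h | h
      · exact absurd h hbs
      · exact absurd h hv'
    · exact h
  by_contra hne
  have hts : v * w ≠ 0 := by rw [← hw]; exact sub_ne_zero.2 hne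
  have htm := mem_monics.1 (hS (hS' ht))
  have hsm := mem_monics.1 (hS (hS' hs))
  have hlt : (v * w).natDegree < d := by
    rw [← hw, ← htm.2]
    refine natDegree_lt_natDegree (sub_ne_zero.2 hne) (degree_sub_lt_left ?_ htm.1.ne_zero ?_)
    · rw [degree_eq_natDegree htm.1.ne_zero, degree_eq_natDegree hsm.1.ne_zero, htm.2, hsm.2]
    · rw [htm.1.leadingCoeff, hsm.1.leadingCoeff]
  have := natDegree_le_of_dvd hvw (right_ne_zero_of_mul hts)
  rw [natDegree_mul (left_ne_zero_of_mul hts) (right_ne_zero_of_mul hts)] at hlt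
  omega

end Sieve

section Sparse

variable {F : Type*} [Field F] [Fintype F] {n : ℕ}

/-- Few tuples of monic polynomials of degree `d` lie in `S`. -/
def Sparse (S : Set (Fin n → F[X])) : Prop :=
  ∃ K : ℕ, ∀ d, 1 ≤ d → ∀ U : Finset (Fin n → F[X]), (∀ t ∈ U, t ∈ S ∧ ∀ i, t i ∈ monics F d) →
    U.card * Fintype.card F ^ (d / 2) ≤ K * d * Fintype.card F ^ (d * n)

theorem Sparse.mono {S S' : Set (Fin n → F[X])} (h : Sparse S') (hS : S ⊆ S') : Sparse S := by
  obtain ⟨K, hK⟩ := h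
  exact ⟨K, fun d hd U hU => hK d hd U fun t ht => ⟨hS (hU t ht).1, (hU t ht).2⟩⟩

theorem sparse_empty : Sparse (∅ : Set (Fin n → F[X])) :=
  ⟨0, fun d _ U hU => by
    rw [Finset.eq_empty_of_forall_notMem fun t ht => (hU t ht).1]
    simp⟩

theorem Sparse.union {S S' : Set (Fin n → F[X])} (h : Sparse S) (h' : Sparse S') :
    Sparse (S ∪ S') := by
  classical
  obtain ⟨K, hK⟩ := h
  obtain ⟨K', hK'⟩ := h'
  refine ⟨K + K', fun d hd U hU => ?_⟩
  have h1 := hK d hd (U.filter (· ∈ S)) fun t ht =>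
    ⟨(Finset.mem_filter.1 ht).2, (hU t (Finset.mem_filter.1 ht).1).2⟩
  have h2 := hK' d hd (U.filter (¬ · ∈ S)) fun t ht =>
    ⟨(hU t (Finset.mem_filter.1 ht).1).1.resolve_left (Finset.mem_filter.1 ht).2,
      (hU t (Finset.mem_filter.1 ht).1).2⟩
  rw [← Finset.card_filter_add_card_filter_not (s := U) (· ∈ S), add_mul, add_mul, add_mul]
  exact add_le_add h1 h2

theorem Sparse.biUnion {ι : Type*} (s : Finset ι) {S : ι → Set (Fin n → F[X])}
    (h : ∀ i ∈ s, Sparse (S i)) : Sparse (⋃ i ∈ s, S i) := by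
  classical
  induction s using Finset.induction_on with
  | empty => exact sparse_empty.mono (by simp)
  | insert a s _ ih =>
    rw [Finset.set_biUnion_insert]
    exact (h a (Finset.mem_insert_self _ _)).union
      (ih fun i hi => h i (Finset.mem_insert_of_mem hi))

theorem card_le_of_forall_mem_monics {d : ℕ} {U : Finset (Fin n → F[X])}
    (hU : ∀ t ∈ U, ∀ i, t i ∈ monics F d) : U.card ≤ Fintype.card F ^ (d * n) := by
  classical
  calc U.card ≤ (Fintype.piFinset fun _ : Fin n => monics F d).card :=
        Finset.card_le_card fun t ht => Fintype.mem_piFinset.2 (hU t ht)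
    _ = _ := by simp [card_monics, pow_mul]

/-- A set is sparse if its slices outside a sparse set of parameters are uniformly small. -/
theorem Sparse.of_slices {S : Set (Fin (n + 1) → F[X])} {S' : Set (Fin n → F[X])}
    (hS' : Sparse S') (K : ℕ) (h : ∀ d, 1 ≤ d → ∀ t' ∉ S', (∀ i, t' i ∈ monics F d) →
      ∀ V ⊆ monics F d, (∀ t ∈ V, (Fin.cons t t' : Fin (n + 1) → F[X]) ∈ S) →
      V.card * Fintype.card F ^ (d / 2) ≤ K * d * Fintype.card F ^ d) : Sparse S := by
  classical
  obtain ⟨K', hK'⟩ := hS'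
  refine ⟨K' + K, fun d hd U hU => ?_⟩
  have hq := one_lt_card (F := F)
  set q := Fintype.card F
  have hinj : ∀ (U' : Finset (Fin (n + 1) → F[X])) (t' : Fin n → F[X]),
      (∀ t ∈ U', Fin.tail t = t') → U'.card = (U'.image (fun t => t 0)).card := by
    intro U' t' h'
    refine (Finset.card_image_of_injOn fun a ha b hb hab => ?_).symm
    rw [← Fin.cons_self_tail a, ← Fin.cons_self_tail b, h' a ha, h' b hb]
    exact congrArg (fun x => (Fin.cons x t' : Fin (n + 1) → F[X])) hab
  let tl : (Fin (n + 1) → F[X]) → Fin n → F[X] := Fin.tail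
  set U1 := U.filter (tl · ∈ S') with hU1
  set U2 := U.filter (¬ tl · ∈ S') with hU2
  have h1 : U1.card * q ^ (d / 2) ≤ K' * d * q ^ (d * (n + 1)) := by
    have hc : U1.card ≤ q ^ d * (U1.image tl).card := by
      refine Finset.card_le_mul_card_image U1 _ fun t' _ => ?_
      rw [hinj _ t' fun t ht => (Finset.mem_filter.1 ht).2, ← card_monics]
      refine Finset.card_le_card fun x hx => ?_
      obtain ⟨t, ht, rfl⟩ := Finset.mem_image.1 hx
      exact (hU t (Finset.mem_filter.1 (Finset.mem_filter.1 ht).1).1).2 0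
    have hi := hK' d hd (U1.image tl) fun x hx => by
      obtain ⟨t, ht, rfl⟩ := Finset.mem_image.1 hx
      obtain ⟨ht1, ht2⟩ := Finset.mem_filter.1 ht
      exact ⟨ht2, fun i => (hU t ht1).2 i.succ⟩
    calc U1.card * q ^ (d / 2) ≤ q ^ d * (U1.image tl).card * q ^ (d / 2) := by gcongr
      _ = q ^ d * ((U1.image tl).card * q ^ (d / 2)) := by ring
      _ ≤ q ^ d * (K' * d * q ^ (d * n)) := by gcongr
      _ = _ := by ring
  have h2 : U2.card * q ^ (d / 2) ≤ K * d * q ^ (d * (n + 1)) := by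
    have hc : U2.card ≤ (K * d * q ^ d / q ^ (d / 2)) * (U2.image tl).card := by
      refine Finset.card_le_mul_card_image U2 _ fun t' ht' => ?_
      rw [hinj _ t' fun t ht => (Finset.mem_filter.1 ht).2,
        Nat.le_div_iff_mul_le (Nat.pow_pos (by omega))]
      obtain ⟨s, hs, rfl⟩ := Finset.mem_image.1 ht'
      obtain ⟨hs1, hs2⟩ := Finset.mem_filter.1 hs
      refine h d hd (tl s) hs2 (fun i => (hU s hs1).2 i.succ) _ (fun x hx => ?_)
        (fun x hx => ?_)
      · obtain ⟨t, ht, rfl⟩ := Finset.mem_image.1 hx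
        exact (hU t (Finset.mem_filter.1 (Finset.mem_filter.1 ht).1).1).2 0
      · obtain ⟨t, ht, rfl⟩ := Finset.mem_image.1 hx
        obtain ⟨ht1, ht2⟩ := Finset.mem_filter.1 ht
        rw [← ht2, Fin.cons_self_tail]
        exact (hU t (Finset.mem_filter.1 ht1).1).1
    have hi : (U2.image tl).card ≤ q ^ (d * n) := card_le_of_forall_mem_monics fun x hx => by
      obtain ⟨t, ht, rfl⟩ := Finset.mem_image.1 hx
      exact fun i => (hU t (Finset.mem_filter.1 ht).1).2 i.succ
    calc U2.card * q ^ (d / 2) ≤ (K * d * q ^ d / q ^ (d / 2)) * q ^ (d * n) * q ^ (d / 2) := by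
          gcongr
          exact hc.trans (by gcongr)
      _ = (K * d * q ^ d / q ^ (d / 2)) * q ^ (d / 2) * q ^ (d * n) := by ring
      _ ≤ K * d * q ^ d * q ^ (d * n) := by
          exact Nat.mul_le_mul_right _ (Nat.div_mul_le_self _ _)
      _ = _ := by ring
  rw [← Finset.card_filter_add_card_filter_not (s := U) (tl · ∈ S'), add_mul, add_mul,
    add_mul]
  exact add_le_add h1 h2

theorem card_mul_le_of_card_le {D d : ℕ} (hd : 1 ≤ d) {V : Finset F[X]} (hV : V.card ≤ D) :
    V.card * Fintype.card F ^ (d / 2) ≤ D * d * Fintype.card F ^ d := by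
  refine Nat.mul_le_mul (hV.trans (Nat.le_mul_of_pos_right _ hd)) ?_
  exact Nat.pow_le_pow_right (by have := one_lt_card (F := F); omega) (Nat.div_le_self _ _)

omit [Fintype F] in
theorem eval_cons_eq (t : F[X]) (t' : Fin n → F[X]) :
    MvPolynomial.eval (Fin.cons t t' : Fin (n + 1) → F[X]) =
      ((evalRingHom t).comp (mapRingHom (MvPolynomial.eval t'))).comp
        (MvPolynomial.finSuccEquiv F[X] n : MvPolynomial (Fin (n + 1)) F[X] →+*
          (MvPolynomial (Fin n) F[X])[X]) := by
  refine RingHom.ext fun a => ?_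
  exact MvPolynomial.eval_eq_eval_mv_eval' t' t a

theorem sparse_eval_eq_zero {a : MvPolynomial (Fin n) F[X]} (ha : a ≠ 0) :
    Sparse {t | MvPolynomial.eval t a = 0} := by
  classical
  induction n with
  | zero =>
    refine sparse_empty.mono fun t ht => ha ?_
    rw [Set.mem_ofPred_eq, MvPolynomial.eq_C_of_isEmpty a, MvPolynomial.eval_C] at ht
    rw [MvPolynomial.eq_C_of_isEmpty a, ht, map_zero]
  | succ n ih =>
    set b := MvPolynomial.finSuccEquiv F[X] n a with hb
    have hb0 : b ≠ 0 := by simpa [hb] using ha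
    refine Sparse.of_slices (ih (leadingCoeff_ne_zero.2 hb0)) b.natDegree ?_
    intro d hd t' ht' _ V hV h
    refine card_mul_le_of_card_le hd ?_
    have hne : b.map (MvPolynomial.eval t') ≠ 0 := fun h0 => ht' (by
      have := congrArg (fun p => coeff p b.natDegree) h0
      simpa using this)
    refine (card_le_degree_of_subset_roots (p := b.map (MvPolynomial.eval t')) ?_).trans
      natDegree_map_le
    intro t ht
    rw [mem_roots hne, IsRoot, hb, ← MvPolynomial.eval_eq_eval_mv_eval']
    exact h t ht

omit [Fintype F] in
theorem exists_natDegree_eval_le (a : MvPolynomial (Fin n) F[X]) :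
    ∃ E, ∀ d, 1 ≤ d → ∀ t : Fin n → F[X], (∀ i, (t i).natDegree ≤ d) →
      (MvPolynomial.eval t a).natDegree ≤ E * d := by
  induction a using MvPolynomial.induction_on with
  | C c =>
    exact ⟨c.natDegree, fun d hd t _ => by
      rw [MvPolynomial.eval_C]
      exact Nat.le_mul_of_pos_right _ hd⟩
  | add a b ha hb =>
    obtain ⟨E, hE⟩ := ha
    obtain ⟨E', hE'⟩ := hb
    refine ⟨E + E', fun d hd t ht => ?_⟩
    rw [map_add, add_mul]
    exact (natDegree_add_le _ _).trans (max_le ((hE d hd t ht).trans (Nat.le_add_right _ _))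
      ((hE' d hd t ht).trans (Nat.le_add_left _ _)))
  | mul_X a i ha =>
    obtain ⟨E, hE⟩ := ha
    refine ⟨E + 1, fun d hd t ht => ?_⟩
    rw [map_mul, MvPolynomial.eval_X, add_mul, one_mul]
    exact natDegree_mul_le.trans (add_le_add (hE d hd t ht) (ht i))

theorem exists_forall_coeff {R : Type*} [Semiring R] {P : R → ℕ → Prop}
    (hP : ∀ a E E', E ≤ E' → P a E → P a E') (h : ∀ a, ∃ E, P a E) (p : R[X]) :
    ∃ E, ∀ i, P (p.coeff i) E := by
  choose E hE using h
  refine ⟨E 0 + ∑ i ∈ Finset.range (p.natDegree + 1), E (p.coeff i), fun i => ?_⟩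
  rcases lt_or_ge p.natDegree i with hi | hi
  · rw [coeff_eq_zero_of_natDegree_lt hi]
    exact hP _ _ _ (Nat.le_add_right _ _) (hE 0)
  · refine hP _ _ _ (le_add_left ?_) (hE (p.coeff i))
    exact Finset.single_le_sum (f := fun i => E (p.coeff i)) (fun _ _ => Nat.zero_le _)
      (Finset.mem_range.2 (by omega))

theorem exists_lt_pow {q : ℕ} (hq : 1 < q) (K D : ℕ) : ∃ d, 1 ≤ d ∧ K * d + D < q ^ (d / 2) := by
  refine ⟨4 * (4 * K + D + 1), by omega, ?_⟩
  set l := 4 * K + D + 1 with hl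
  have h1 : l < q ^ l := Nat.lt_pow_self hq
  rw [show 4 * l / 2 = l + l by omega, pow_add]
  nlinarith

end Sparse

section Roots

variable {F : Type*} [Field F] [Fintype F] {n : ℕ}

/-- `F[u][T] ≃ F[T][u]` -/
noncomputable def swapEquiv (F : Type*) [Field F] (n : ℕ) :
    MvPolynomial (Fin n) F[X] ≃ₐ[F] (MvPolynomial (Fin n) F)[X] :=
  (MvPolynomial.optionEquivRight F (Fin n)).symm.trans (MvPolynomial.optionEquivLeft F (Fin n))

omit [Fintype F] in
theorem swapEquiv_C (p : F[X]) :
    swapEquiv F n (MvPolynomial.C p) = p.map (algebraMap F (MvPolynomial (Fin n) F)) := by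
  have h : ((swapEquiv F n).toAlgHom.comp (IsScalarTower.toAlgHom F F[X]
      (MvPolynomial (Fin n) F[X]))) = mapAlgHom (Algebra.ofId F (MvPolynomial (Fin n) F)) := by
    refine Polynomial.algHom_ext ?_
    have : (MvPolynomial.optionEquivRight F (Fin n)).symm (MvPolynomial.C X) =
        MvPolynomial.X none := by
      rw [AlgEquiv.symm_apply_eq, MvPolynomial.optionEquivRight_X_none]
    simp [swapEquiv, MvPolynomial.algebraMap_eq, this, MvPolynomial.optionEquivLeft_X_none]
  exact DFunLike.congr_fun h p

omit [Fintype F] in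
theorem map_evalRingHom_comp {R S : Type*} [CommRing R] [CommRing S] (φ : R →+* S) (x : R) :
    (evalRingHom (φ x)).comp (mapRingHom φ) = φ.comp (evalRingHom x) := by
  refine RingHom.ext fun p => ?_
  simp [eval_map_apply]

/-- Hilbert irreducibility for rational roots, existence form in one variable. -/
theorem exists_specialization_no_root {B : Type*} [CommRing B] [IsDomain B]
    [UniqueFactorizationMonoid B] [Algebra F B] (ρ : B →ₐ[F] F) {g α β : B[X][X][X]}
    {Δ : B[X][X]} (hg : g.Monic) (hroot : ∀ r, g.eval r ≠ 0)
    (hab : α * g + β * derivative g = C Δ) (hΔ : Δ ≠ 0) :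
    ∃ τ : F[X], (∀ y, (g.map (evalRingHom (τ.map (algebraMap F B)))).eval y ≠ 0) ∧
      Δ.eval (τ.map (algebraMap F B)) ≠ 0 := by
  classical
  by_contra! hcon
  obtain ⟨D, hD⟩ := exists_forall_coeff (P := fun a E => natDegree a ≤ E)
    (fun a E E' h h' => h'.trans h) (fun a => ⟨_, le_rfl⟩) g
  obtain ⟨E, hE⟩ := exists_forall_coeff (P := fun (a : B[X][X]) E => ∀ j, (a.coeff j).natDegree ≤ E)
    (fun a E E' h h' j => (h' j).trans h)
    (exists_forall_coeff (P := fun a E => natDegree a ≤ E)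
      (fun a E E' h h' => h'.trans h) (fun a => ⟨_, le_rfl⟩)) g
  obtain ⟨E', hE'⟩ := exists_forall_coeff (P := fun a E => natDegree a ≤ E)
    (fun a E E' h h' => h'.trans h) (fun a => ⟨_, le_rfl⟩) Δ
  obtain ⟨K, hK⟩ := exists_card_root_le ρ g.natDegree (D + Δ.natDegree) (E + E')
  obtain ⟨d, hd, hlt⟩ := exists_lt_pow (one_lt_card (F := F)) K Δ.natDegree
  have hle : ∀ a : ℕ, a ≤ E ∨ a ≤ E' → a ≤ (E + E') * d := fun a ha =>
    le_trans (by omega) (Nat.le_mul_of_pos_right _ hd)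
  set ι := algebraMap F B
  set S := (monics F d).filter fun t => ∃ y, (g.map (evalRingHom (t.map ι))).eval y = 0
  set S' := (monics F d).filter fun t => ¬ ∃ y, (g.map (evalRingHom (t.map ι))).eval y = 0
  have h1 := hK d hd g α β Δ hg le_rfl (fun i => (hD i).trans (Nat.le_add_right _ _))
    (fun i j => hle _ (Or.inl (hE i j))) hroot hab hΔ (Nat.le_add_left _ _)
    (fun j => hle _ (Or.inr (hE' j))) S (Finset.filter_subset _ _)
    (fun t ht => (Finset.mem_filter.1 ht).2)
  have h2 : S'.card ≤ Δ.natDegree := by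
    rw [← Finset.card_image_of_injective _ (map_injective ι ι.injective)]
    refine card_le_degree_of_subset_roots fun x hx => ?_
    obtain ⟨t, ht, rfl⟩ := Finset.mem_image.1 (Finset.mem_def.2 hx)
    rw [mem_roots hΔ]
    have := (Finset.mem_filter.1 ht).2
    push Not at this
    exact hcon t this
  have h3 : S.card + S'.card = Fintype.card F ^ d := by
    rw [← card_monics]
    exact Finset.card_filter_add_card_filter_not _
  have hq := one_lt_card (F := F)
  have hpos : 0 < Fintype.card F ^ d := Nat.pow_pos (by omega)
  have h4 : Fintype.card F ^ (d / 2) ≤ Fintype.card F ^ d :=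
    Nat.pow_le_pow_right (by omega) (Nat.div_le_self _ _)
  have h5 : (Fintype.card F ^ d) * Fintype.card F ^ (d / 2) ≤
      (K * d + Δ.natDegree) * Fintype.card F ^ d := by
    rw [← h3, add_mul, h3, add_mul]
    exact add_le_add h1 (Nat.mul_le_mul h2 h4)
  rw [mul_comm] at h5
  exact absurd (Nat.le_of_mul_le_mul_right h5 hpos) (by omega)

omit [Fintype F] in
theorem eval_map_ringEquiv_ne_zero {R S : Type*} [CommRing R] [CommRing S] (φ : R ≃+* S) {g : R[X]}
    (hroot : ∀ r, g.eval r ≠ 0) (r : S) : (g.map (φ : R →+* S)).eval r ≠ 0 := by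
  intro h
  refine hroot (φ.symm r) (φ.injective ?_)
  have := eval_map_apply (f := (φ : R →+* S)) (φ.symm r) (p := g)
  rw [RingEquiv.coe_toRingHom, φ.apply_symm_apply, h] at this
  rw [map_zero, ← this]

omit [Fintype F] in
theorem map_certificate {R S : Type*} [CommRing R] [CommRing S] (φ : R →+* S) {g α β : R[X]} {Δ : R}
    (h : α * g + β * derivative g = C Δ) :
    α.map φ * g.map φ + β.map φ * derivative (g.map φ) = C (φ Δ) := by
  rw [derivative_map, ← Polynomial.map_mul, ← Polynomial.map_mul, ← Polynomial.map_add, h, map_C]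

theorem exists_specialization_of_equiv {A B : Type*} [CommRing A] [CommRing B] [IsDomain B]
    [UniqueFactorizationMonoid B] [Algebra F B] (ρ : B →ₐ[F] F) (ψ : A ≃+* B[X]) (c : F[X] → A)
    (hc : ∀ p, ψ (c p) = p.map (algebraMap F B)) {g α β : A[X][X]} {Δ : A[X]}
    (hg : g.Monic) (hroot : ∀ r, g.eval r ≠ 0) (hab : α * g + β * derivative g = C Δ) (hΔ : Δ ≠ 0) :
    ∃ τ : F[X], (∀ y, (g.map (evalRingHom (c τ))).eval y ≠ 0) ∧ Δ.eval (c τ) ≠ 0 := by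
  let Ψ : A[X] ≃+* B[X][X] := mapEquiv ψ
  have hΨ : (Ψ : A[X] →+* B[X][X]) = mapRingHom (ψ : A →+* B[X]) := rfl
  obtain ⟨τ, hτ1, hτ2⟩ := exists_specialization_no_root ρ (hg.map (Ψ : A[X] →+* B[X][X]))
    (eval_map_ringEquiv_ne_zero Ψ hroot) (map_certificate (Ψ : A[X] →+* B[X][X]) hab)
    ((map_ne_zero_iff _ Ψ.injective).2 hΔ)
  rw [← hc] at hτ1 hτ2
  refine ⟨τ, fun r hr => hτ1 (ψ r) ?_, fun h0 => hτ2 ?_⟩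
  · have := map_evalRingHom_comp (ψ : A →+* B[X]) (c τ)
    rw [RingEquiv.coe_toRingHom] at this
    rw [Polynomial.map_map, hΨ, this, ← Polynomial.map_map]
    have := eval_map_apply (f := (ψ : A →+* B[X])) r (p := g.map (evalRingHom (c τ)))
    rw [hr, map_zero] at this
    exact this
  · have := eval_map_apply (f := (ψ : A →+* B[X])) (c τ) (p := Δ)
    rw [h0, map_zero] at this
    exact this

/-- A monic separable polynomial without roots has few specializations with a root. -/
theorem sparse_exists_root {g α β : (MvPolynomial (Fin n) F[X])[X]} {Δ : MvPolynomial (Fin n) F[X]}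
    (hg : g.Monic) (hroot : ∀ r, g.eval r ≠ 0) (hab : α * g + β * derivative g = C Δ)
    (hΔ : Δ ≠ 0) : Sparse {t | ∃ y, (g.map (MvPolynomial.eval t)).eval y = 0} := by
  induction n with
  | zero =>
    refine sparse_empty.mono ?_
    rintro t ⟨y, hy⟩
    refine hroot (MvPolynomial.C y) ?_
    have h : MvPolynomial.eval t (g.eval (MvPolynomial.C y)) = 0 := by
      rw [← eval_map_apply, MvPolynomial.eval_C, hy]
    rw [MvPolynomial.eq_C_of_isEmpty (eval _ g), MvPolynomial.eval_C] at h
    rw [MvPolynomial.eq_C_of_isEmpty (eval _ g), h, map_zero]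
  | succ n ih =>
    let φ : MvPolynomial (Fin (n + 1)) F[X] ≃+* (MvPolynomial (Fin n) F[X])[X] :=
      (MvPolynomial.finSuccEquiv F[X] n).toRingEquiv
    set g₁ := g.map (φ : _ →+* (MvPolynomial (Fin n) F[X])[X]) with hg₁
    have hg₁m : g₁.Monic := hg.map _
    have hroot₁ := eval_map_ringEquiv_ne_zero (S := (MvPolynomial (Fin n) F[X])[X]) φ hroot
    have hab₁ := map_certificate (S := (MvPolynomial (Fin n) F[X])[X])
      (φ : _ →+* (MvPolynomial (Fin n) F[X])[X]) hab
    set Δ₁ := φ Δ with hΔ₁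
    have hΔ₁0 : Δ₁ ≠ 0 := (map_ne_zero_iff _ φ.injective).2 hΔ
    obtain ⟨τ, hhroot, hhΔ⟩ := exists_specialization_of_equiv
      (MvPolynomial.aeval (fun _ => (0 : F)) : MvPolynomial (Fin n) F →ₐ[F] F)
      (swapEquiv F n).toRingEquiv MvPolynomial.C swapEquiv_C hg₁m hroot₁ hab₁ hΔ₁0
    set x : MvPolynomial (Fin n) F[X] := MvPolynomial.C τ with hx
    set h := g₁.map (evalRingHom x) with hh
    have hhm : h.Monic := hg₁m.map _
    have hhab := map_certificate (evalRingHom x) hab₁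
    have hsp := (ih hhm hhroot hhab hhΔ).union (sparse_eval_eq_zero hhΔ)
    obtain ⟨D, hD⟩ := exists_forall_coeff (P := fun a E => natDegree a ≤ E)
      (fun a E E' h h' => h'.trans h) (fun a => ⟨_, le_rfl⟩) g₁
    have hdeg : ∀ b : (MvPolynomial (Fin n) F[X])[X], ∃ E, ∀ j, ∀ d, 1 ≤ d →
        ∀ t : Fin n → F[X], (∀ i, (t i).natDegree ≤ d) →
          (MvPolynomial.eval t (b.coeff j)).natDegree ≤ E * d :=
      exists_forall_coeff (P := fun (a : MvPolynomial (Fin n) F[X]) E => ∀ d, 1 ≤ d →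
        ∀ t : Fin n → F[X], (∀ i, (t i).natDegree ≤ d) →
          (MvPolynomial.eval t a).natDegree ≤ E * d)
        (fun a E E' h h' d hd t ht => (h' d hd t ht).trans (Nat.mul_le_mul_right _ h))
        exists_natDegree_eval_le
    obtain ⟨E, hE⟩ := exists_forall_coeff (P := fun (b : (MvPolynomial (Fin n) F[X])[X]) E =>
      ∀ j, ∀ d, 1 ≤ d → ∀ t : Fin n → F[X], (∀ i, (t i).natDegree ≤ d) →
          (MvPolynomial.eval t (b.coeff j)).natDegree ≤ E * d)
        (fun a E E' h h' j d hd t ht => (h' j d hd t ht).trans (Nat.mul_le_mul_right _ h))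
        hdeg g₁
    obtain ⟨E', hE'⟩ := hdeg Δ₁
    obtain ⟨K, hK⟩ := exists_card_root_le (AlgHom.id F F) g.natDegree (D + Δ₁.natDegree) (E + E')
    refine hsp.of_slices K ?_
    intro d hd t' ht' ht'm V hV hVS
    rw [Set.mem_union, not_or] at ht'
    obtain ⟨ht1, ht2⟩ := ht'
    simp only [Set.mem_ofPred_eq, not_exists] at ht1 ht2
    have ht'd : ∀ i, (t' i).natDegree ≤ d := fun i => (mem_monics.1 (ht'm i)).2.le
    set ev := MvPolynomial.eval t' with hev
    have hevx : ev x = τ := MvPolynomial.eval_C τ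
    let Ev : (MvPolynomial (Fin n) F[X])[X] →+* F[X][X] := mapRingHom ev
    have hab₂ := map_certificate (S := F[X][X]) Ev hab₁
    refine hK d hd (g₁.map Ev) _ _ (Ev Δ₁) (hg₁m.map _)
      (natDegree_map_le.trans natDegree_map_le) ?_ ?_ ?_ hab₂ ?_
      ?_ ?_ V hV ?_
    · intro i
      rw [coeff_map]
      exact natDegree_map_le.trans ((hD i).trans (Nat.le_add_right _ _))
    · intro i j
      rw [coeff_map, coe_mapRingHom, coeff_map]
      exact (hE i j d hd t' ht'd).trans (Nat.mul_le_mul_right _ (Nat.le_add_right _ _))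
    · intro r hr
      refine ht1 (r.eval τ) ?_
      have h1 := eval_map_apply (f := evalRingHom τ) r (p := g₁.map (mapRingHom ev))
      rw [hr, map_zero, Polynomial.map_map, ← hevx, map_evalRingHom_comp, ← Polynomial.map_map,
        hevx] at h1
      exact h1
    · intro h0
      refine ht2 ?_
      rw [← eval_map_apply, hevx]
      exact (congrArg (eval τ) h0).trans eval_zero
    · exact natDegree_map_le.trans (Nat.le_add_left _ _)
    · intro j
      rw [coe_mapRingHom, coeff_map]
      exact (hE' j d hd t' ht'd).trans (Nat.mul_le_mul_right _ (Nat.le_add_left _ _))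
    · intro t ht
      obtain ⟨y, hy⟩ := hVS t ht
      refine ⟨y, ?_⟩
      rw [eval_cons_eq] at hy
      rw [Algebra.algebraMap_self, Polynomial.map_id, hg₁, Polynomial.map_map, Polynomial.map_map]
      exact hy

end Roots

section Powers

theorem exists_pow_eq_expand {R : Type*} [CommRing R] (p : ℕ) [Fact p.Prime] [CharP R p] {f : R[X]}
    (h : ∀ i, ∃ b, f.coeff i = b ^ p) : ∃ b, expand R p f = b ^ p := by
  choose b hb using h
  refine ⟨∑ i ∈ Finset.range (f.natDegree + 1), C (b i) * X ^ i, ?_⟩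
  rw [sum_pow_char]
  conv_lhs => rw [f.as_sum_range_C_mul_X_pow, map_sum]
  refine Finset.sum_congr rfl fun i _ => ?_
  rw [map_mul, expand_C, map_pow, expand_X, mul_pow, ← C_pow, ← hb, ← pow_mul, ← pow_mul,
    mul_comm p]

theorem derivative_eval_of_derivative_eq_zero {R : Type*} [CommRing R] (c : R[X][X]) {s : R[X]}
    (hs : derivative s = 0) : derivative (c.eval s) =
      (∑ i ∈ Finset.range (c.natDegree + 1), C (derivative (c.coeff i)) * X ^ i).eval s := by
  rw [eval_eq_sum_range, derivative_sum, eval_finsetSum]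
  refine Finset.sum_congr rfl fun i _ => ?_
  simp [derivative_mul, derivative_pow, hs]

variable {F : Type*} [Field F] [Fintype F] {n : ℕ}

/-- A polynomial which is not a `p`-th power has few specializations that are `p`-th powers. -/
theorem sparse_derivative_eq_zero (p : ℕ) [Fact p.Prime] [CharP F p]
    {a : MvPolynomial (Fin n) F[X]} (ha : ∀ b, a ≠ b ^ p) :
    Sparse {t | derivative (MvPolynomial.eval t a) = 0} := by
  classical
  have hp : p ≠ 0 := (Fact.out : p.Prime).ne_zero
  induction n with
  | zero =>
    refine sparse_empty.mono fun t ht => ?_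
    rw [Set.mem_ofPred_eq, MvPolynomial.eq_C_of_isEmpty a, MvPolynomial.eval_C] at ht
    have h := expand_contract p ht hp
    rw [polynomial_expand_eq] at h
    refine ha (MvPolynomial.C ((contract p (MvPolynomial.coeff 0 a)).map
      ((frobeniusEquiv F p).symm : F →+* F))) ?_
    rw [← map_pow, h]
    exact MvPolynomial.eq_C_of_isEmpty a
  | succ n ih =>
    let φ := MvPolynomial.finSuccEquiv F[X] n
    set b := φ a with hb
    have hev : ∀ (t : F[X]) (t' : Fin n → F[X]),
        MvPolynomial.eval (Fin.cons t t' : Fin (n + 1) → F[X]) a =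
        (b.map (MvPolynomial.eval t')).eval t := fun t t' =>
      MvPolynomial.eval_eq_eval_mv_eval' t' t a
    by_cases hder : derivative b = 0
    · obtain ⟨i, hi⟩ : ∃ i, ∀ r, (contract p b).coeff i ≠ r ^ p := by
        by_contra! h
        obtain ⟨r, hr⟩ := exists_pow_eq_expand p h
        rw [expand_contract p hder hp] at hr
        refine ha (φ.symm r) (φ.injective ?_)
        rw [map_pow, φ.apply_symm_apply, ← hr]
      refine (ih hi).of_slices ((contract p b).natDegree * p) ?_
      intro d hd t' ht' _ V hV hVS
      refine card_mul_le_of_card_le hd ?_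
      set c := (contract p b).map (MvPolynomial.eval t') with hc
      set w := ∑ i ∈ Finset.range (c.natDegree + 1), C (derivative (c.coeff i)) * X ^ i with hw
      have hwi : w.coeff i = derivative (c.coeff i) := by
        rw [hw, finsetSum_coeff]
        simp only [coeff_C_mul_X_pow]
        rw [Finset.sum_ite_eq]
        split_ifs with h
        · rfl
        · rw [coeff_eq_zero_of_natDegree_lt (by simpa [Nat.lt_succ_iff] using h), derivative_zero]
      have hw0 : expand F[X] p w ≠ 0 := by
        rw [expand_ne_zero (Nat.pos_of_ne_zero hp)]
        intro h0
        rw [h0, coeff_zero, hc, coeff_map] at hwi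
        exact ht' hwi.symm
      refine (card_le_degree_of_subset_roots (p := expand F[X] p w) ?_).trans ?_
      · intro t ht
        rw [mem_roots hw0, IsRoot, expand_eval]
        have h := hVS t (Finset.mem_def.2 ht)
        rw [Set.mem_ofPred_eq, hev, ← expand_contract p hder hp, map_expand, expand_eval] at h
        rw [hw, ← derivative_eval_of_derivative_eq_zero c, hc]
        · exact h
        · rw [derivative_pow, CharP.cast_eq_zero, map_zero, zero_mul, zero_mul]
      · rw [natDegree_expand]
        refine Nat.mul_le_mul_right _ (le_trans ?_ (natDegree_map_le (f := MvPolynomial.eval t')))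
        refine natDegree_sum_le_of_forall_le _ _ fun j hj => ?_
        exact (natDegree_C_mul_X_pow_le _ _).trans (by simpa [Nat.lt_succ_iff] using hj)
    · obtain ⟨j, hj⟩ : ∃ j, (derivative b).coeff j ≠ 0 := by
        by_contra! h
        exact hder (Polynomial.ext fun i => by simpa using h i)
      obtain ⟨E, hE⟩ := exists_forall_coeff (P := fun (a : MvPolynomial (Fin n) F[X]) E =>
        ∀ d, 1 ≤ d → ∀ t : Fin n → F[X], (∀ i, (t i).natDegree ≤ d) →
          (MvPolynomial.eval t a).natDegree ≤ E * d)
        (fun a E E' h h' d hd t ht => (h' d hd t ht).trans (Nat.mul_le_mul_right _ h))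
        exists_natDegree_eval_le b
      obtain ⟨K, hK⟩ := exists_card_derivative_eq_zero_le F b.natDegree E
      refine (sparse_eval_eq_zero hj).of_slices K ?_
      intro d hd t' ht' ht'm V hV hVS
      refine hK d hd (b.map (MvPolynomial.eval t')) ?_ natDegree_map_le ?_ V hV ?_
      · intro h0
        refine ht' ?_
        rw [derivative_map] at h0
        have := congrArg (fun f => coeff f j) h0
        simpa using this
      · intro i
        rw [coeff_map]
        exact hE i d hd t' fun i => (mem_monics.1 (ht'm i)).2.le
      · intro t ht
        rw [← hev]
        exact hVS t ht

end Powers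

section SubsetProducts

universe u

/-- The generic polynomial whose roots are the products of `r` of the differences `l - X i`. -/
noncomputable def subsetProductPoly {R : Type u} [CommRing R] (N r : ℕ) (l : R) :
    (MvPolynomial (Fin N) R)[X] :=
  ∏ T ∈ Finset.powersetCard r Finset.univ,
    (X - C (∏ i ∈ T, (MvPolynomial.C l - MvPolynomial.X i)))

theorem coeff_subsetProductPoly_isSymmetric {R : Type u} [CommRing R] (N r : ℕ) (l : R) (k : ℕ) :
    ((subsetProductPoly N r l).coeff k).IsSymmetric := by
  intro e
  have : (subsetProductPoly N r l).map (MvPolynomial.rename e).toRingHom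
      = subsetProductPoly N r l := by
    rw [subsetProductPoly, Polynomial.map_prod]
    refine Finset.prod_nbij (fun T => T.map e.toEmbedding) ?_ ?_ ?_ ?_
    · intro T hT
      simpa using hT
    · intro T _ T' _ h
      simpa using h
    · intro T hT
      refine ⟨T.map e.symm.toEmbedding, by simpa using hT, ?_⟩
      ext i
      simp
    · intro T _
      simp [Finset.prod_map, Polynomial.map_prod]
  conv_rhs => rw [← this]
  rw [coeff_map]
  rfl

theorem subsetProductPoly_monic {R : Type u} [CommRing R] (N r : ℕ) (l : R) :
    (subsetProductPoly N r l).Monic :=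
  monic_prod_of_monic _ _ fun _ _ => monic_X_sub_C _

/-- For monic `f` and a shift `l` there is a monic polynomial whose roots, in any field over which
`f` splits, are the values at `l` of the monic products of `r` linear factors of `f`. -/
theorem exists_subset_product_poly {R : Type u} [CommRing R] [Nontrivial R] {f : R[X]}
    (hf : f.Monic) (r : ℕ) (l : R) :
    ∃ g : R[X], g.Monic ∧ ∀ (L : Type u) [Field L] (φ : R →+* L) (s : Multiset L),
      f.map φ = (s.map fun x => X - C x).prod →
      g.map φ = ((s.powersetCard r).map fun T => X - C ((T.map (φ l - ·)).prod)).prod := by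
  classical
  set N := f.natDegree with hN
  let E : MvPolynomial (Fin N) R →+* MvPolynomial (Fin N) R :=
    (MvPolynomial.symmetricSubalgebra (Fin N) R).val.toRingHom.comp
      (MvPolynomial.esymmAlgHom (Fin N) R N).toRingHom
  obtain ⟨U, hU, -, hUm⟩ : ∃ U : (MvPolynomial (Fin N) R)[X],
      U.map E = subsetProductPoly N r l ∧
        U.degree = (subsetProductPoly N r l).degree ∧ U.Monic := by
    refine lifts_and_degree_eq_and_monic ?_ (subsetProductPoly_monic N r l)
    rw [lifts_iff_coeff_lifts]
    intro k
    obtain ⟨y, hy⟩ := MvPolynomial.esymmAlgHom_surjective (σ := Fin N) R (n := N) (by simp)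
      ⟨_, coeff_subsetProductPoly_isSymmetric N r l k⟩
    exact ⟨y, congrArg Subtype.val hy⟩
  let c : Fin N → R := fun i => (-1) ^ (i.1 + 1) * f.coeff (N - (i.1 + 1))
  refine ⟨U.map (MvPolynomial.eval c), hUm.map _, fun L _ φ s hs => ?_⟩
  have hcard : Multiset.card s = N := by
    have := congrArg natDegree hs
    rw [hf.natDegree_map, natDegree_multiset_prod_X_sub_C_eq_card] at this
    exact this.symm
  obtain ⟨x, hx⟩ : ∃ x : Fin N → L, Finset.univ.val.map x = s := by
    obtain ⟨l, rfl⟩ := Quot.exists_rep s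
    refine ⟨fun i => l.get (i.cast hcard.symm), ?_⟩
    change ((List.map _ (List.finRange N) : List L) : Multiset L) = _
    have : N = l.length := hcard.symm
    clear_value N
    subst this
    simp
  have key : (MvPolynomial.eval₂Hom φ x).comp E = φ.comp (MvPolynomial.eval c) := by
    refine MvPolynomial.ringHom_ext (fun a => ?_) fun i => ?_
    · simp [E]
    · have h1 : (MvPolynomial.eval₂Hom φ x) (MvPolynomial.esymm (Fin N) R (i + 1))
          = s.esymm (i + 1) := by
        let _ := φ.toAlgebra
        rw [← hx]
        exact MvPolynomial.aeval_esymm_eq_multiset_esymm (Fin N) R (i + 1) x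
      have h2 := Multiset.prod_X_sub_C_coeff s (k := N - (i + 1)) (by omega)
      rw [← hs, coeff_map, hcard, Nat.sub_sub_self (by omega)] at h2
      have h3 : E (MvPolynomial.X i) = MvPolynomial.esymm (Fin N) R (i + 1) := by
        simp [E, MvPolynomial.esymmAlgHom_apply]
      rw [RingHom.comp_apply, h3, h1, RingHom.comp_apply, MvPolynomial.eval_X, map_mul, h2,
        map_pow, map_neg, map_one, ← mul_assoc, ← mul_pow]
      simp
  rw [Polynomial.map_map, ← key, ← Polynomial.map_map, hU, subsetProductPoly, Polynomial.map_prod,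
    ← hx, Multiset.powersetCard_map, Multiset.map_map, ← Finset.map_val_val_powersetCard,
    Multiset.map_map, Finset.prod_eq_multiset_prod]
  refine congrArg _ (Multiset.map_congr rfl fun T _ => ?_)
  have h (i : Fin N) :
      MvPolynomial.eval₂Hom φ x (MvPolynomial.C l - MvPolynomial.X i) = φ l - x i := by
    simp
  simp only [Function.comp_apply, Multiset.map_map, Polynomial.map_sub, Polynomial.map_X,
    Polynomial.map_C]
  rw [map_prod]
  simp only [h]
  rfl

end SubsetProducts

section Resolvent

universe u

theorem mem_range_map_of_infinite {k E : Type*} [Field k] [Field E] [Algebra k E] {h : E[X]}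
    (hinf : {x : k | h.eval (algebraMap k E x) ∈ (algebraMap k E).range}.Infinite) :
    ∃ P : k[X], P.map (algebraMap k E) = h := by
  obtain ⟨S, hS, hScard⟩ := hinf.exists_subset_card_eq (h.natDegree + 1)
  have hv : ∀ x : k, ∃ v : k, x ∈ S → algebraMap k E v = h.eval (algebraMap k E x) := by
    intro x
    by_cases hx : x ∈ S
    · obtain ⟨v, hv⟩ := hS hx
      exact ⟨v, fun _ => hv⟩
    · exact ⟨0, fun h => absurd h hx⟩
  choose v hv using hv
  classical
  refine ⟨Lagrange.interpolate S id v, ?_⟩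
  have hinj := (algebraMap k E).injective
  refine eq_of_degrees_lt_of_eval_finset_eq (S.map ⟨_, hinj⟩) ?_ ?_ ?_
  · rw [degree_map, Finset.card_map]
    exact Lagrange.degree_interpolate_lt v Function.injective_id.injOn
  · rw [Finset.card_map, hScard]
    exact degree_le_natDegree.trans_lt (by exact_mod_cast Nat.lt_succ_self _)
  · intro y hy
    obtain ⟨x, hx, rfl⟩ := Finset.mem_map.1 hy
    change eval (algebraMap k E x) _ = eval (algebraMap k E x) _
    rw [eval_map_apply, ← hv x hx]
    congr 1
    exact Lagrange.eval_interpolate_at_node v Function.injective_id.injOn hx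

theorem natDegree_eq_zero_or_eq_of_dvd {k : Type*} [Field k] {f P : k[X]} (hf : Irreducible f)
    (h : P ∣ f) : P.natDegree = 0 ∨ P.natDegree = f.natDegree := by
  obtain ⟨Q, rfl⟩ := h
  have h0 := hf.ne_zero
  rw [natDegree_mul (left_ne_zero_of_mul h0) (right_ne_zero_of_mul h0)]
  rcases hf.isUnit_or_isUnit rfl with hu | hu
  · exact Or.inl (natDegree_eq_zero_of_isUnit hu)
  · exact Or.inr (by rw [natDegree_eq_zero_of_isUnit hu, add_zero])

/-- For a generic shift the products of `r` shifted roots are distinct and irrational. -/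
theorem exists_generic_shift {A k E : Type*} [CommRing A] [Infinite A] [Field k] [Field E]
    [Algebra k E] (i : A →+* k) (hi : Function.Injective i) {f : k[X]} (hf : Irreducible f)
    {s : Multiset E} (hs : s.Nodup)
    (hfs : f.map (algebraMap k E) = (s.map fun x => X - C x).prod) {r : ℕ} (h0 : r ≠ 0)
    (hr : r < f.natDegree) :
    ∃ l : A, ((s.powersetCard r).map fun T =>
        (T.map (algebraMap k E (i l) - ·)).prod).Nodup ∧
      ∀ T ∈ s.powersetCard r, ∀ y : k,
        (T.map (algebraMap k E (i l) - ·)).prod ≠ algebraMap k E y := by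
  classical
  set φ := (algebraMap k E).comp i with hφ
  have hφi : Function.Injective φ := (algebraMap k E).injective.comp hi
  have heval (T : Multiset E) (x : E) :
      ((T.map fun x => X - C x).prod).eval x = (T.map (x - ·)).prod := by
    rw [eval_multiset_prod, Multiset.map_map]
    simp
  have hfin₁ : ∀ T T' : Multiset E, T ≠ T' →
      {l : A | (T.map (φ l - ·)).prod = (T'.map (φ l - ·)).prod}.Finite := by
    intro T T' hT
    have hne : (T.map fun x => X - C x).prod - (T'.map fun x => X - C x).prod ≠ 0 := by
      intro h
      apply hT
      have := congrArg roots (sub_eq_zero.1 h)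
      rwa [roots_multiset_prod_X_sub_C, roots_multiset_prod_X_sub_C] at this
    refine ((finite_setOfPred_isRoot hne).preimage hφi.injOn).subset fun l hl => ?_
    simp only [Set.mem_preimage, Set.mem_ofPred_eq, IsRoot, eval_sub, heval] at hl ⊢
    rw [hl, sub_self]
  have hfin₂ : ∀ T ∈ s.powersetCard r,
      {l : A | ∃ y, (T.map (φ l - ·)).prod = algebraMap k E y}.Finite := by
    intro T hT
    obtain ⟨hTs, hTr⟩ := Multiset.mem_powersetCard.1 hT
    by_contra hinf
    obtain ⟨P, hP⟩ := mem_range_map_of_infinite (k := k) (h := (T.map fun x => X - C x).prod) <| by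
      refine (Set.Infinite.image hi.injOn hinf).mono ?_
      rintro _ ⟨l, ⟨y, hy⟩, rfl⟩
      refine ⟨y, ?_⟩
      rw [heval]
      exact hy.symm
    have hPd : P.natDegree = r := by
      rw [← natDegree_map (algebraMap k E), hP, natDegree_multiset_prod_X_sub_C_eq_card, hTr]
    have hdvd : P ∣ f := by
      rw [← map_dvd_map' (algebraMap k E), hP, hfs]
      exact Multiset.prod_dvd_prod_of_le (Multiset.map_le_map hTs)
    rcases natDegree_eq_zero_or_eq_of_dvd hf hdvd with h | h <;> omega
  have hbad : ((⋃ T ∈ {T | T ∈ s.powersetCard r}, ⋃ T' ∈ {T' | T' ∈ s.powersetCard r ∧ T ≠ T'},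
      {l : A | (T.map (φ l - ·)).prod = (T'.map (φ l - ·)).prod}) ∪
      ⋃ T ∈ {T | T ∈ s.powersetCard r},
        {l : A | ∃ y, (T.map (φ l - ·)).prod = algebraMap k E y}).Finite := by
    have hset : {T | T ∈ s.powersetCard r}.Finite := Multiset.finite_toSet _
    refine Set.Finite.union (hset.biUnion fun T _ => ?_) (hset.biUnion hfin₂)
    exact (hset.subset fun T' h => h.1).biUnion fun T' h => hfin₁ T T' h.2
  obtain ⟨l, hl⟩ := hbad.exists_notMem
  simp only [Set.mem_union, Set.mem_iUnion, Set.mem_ofPred_eq, not_or, not_exists, exists_prop,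
    not_and] at hl
  refine ⟨l, ?_, fun T hT y => hl.2 T hT y⟩
  refine (Multiset.Nodup.powersetCard hs).map_on fun T hT T' hT' h => ?_
  by_contra hne
  exact hl.1 T hT T' ⟨hT', hne⟩ h

theorem exists_certificate_of_separable {A k : Type*} [CommRing A] [IsDomain A] [Field k]
    [Algebra A k] [IsFractionRing A k] {g : A[X]} (hg : (g.map (algebraMap A k)).Separable) :
    ∃ (α β : A[X]) (Δ : A), α * g + β * derivative g = C Δ ∧ Δ ≠ 0 := by
  obtain ⟨a, b, hab⟩ := hg
  obtain ⟨c, hc, hca⟩ := IsLocalization.integerNormalization_spec (R := A) (S := k)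
    (nonZeroDivisors A) a
  obtain ⟨e, he, heb⟩ := IsLocalization.integerNormalization_spec (R := A) (S := k)
    (nonZeroDivisors A) b
  refine ⟨C e * IsLocalization.integerNormalization (nonZeroDivisors A) a,
    C c * IsLocalization.integerNormalization (nonZeroDivisors A) b, e * c, ?_,
    nonZeroDivisors.ne_zero (mul_mem he hc)⟩
  apply map_injective _ (IsFractionRing.injective A k)
  simp only [Polynomial.map_add, Polynomial.map_mul, hca, heb, map_C, ← derivative_map]
  simp only [Algebra.smul_def, Polynomial.algebraMap_apply, map_mul]
  linear_combination (C (algebraMap A k e) * C (algebraMap A k c)) * hab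

/-- A rootless separable resolvent that acquires a root whenever a specialization of `f` acquires a
monic factor of degree `r`. -/
theorem exists_resolvent {A : Type u} [CommRing A] [IsDomain A] [Infinite A] {f : A[X]}
    (hf : f.Monic) (hirr : Irreducible (f.map (algebraMap A (FractionRing A))))
    (hsep : (f.map (algebraMap A (FractionRing A))).Separable) {r : ℕ} (h0 : r ≠ 0)
    (hr : r < f.natDegree) :
    ∃ (l : A) (g α β : A[X]) (Δ : A), g.Monic ∧ (∀ x, g.eval x ≠ 0) ∧
      α * g + β * derivative g = C Δ ∧ Δ ≠ 0 ∧
      ∀ (B : Type u) [CommRing B] [IsDomain B] (φ : A →+* B) (h : B[X]), h.Monic →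
        h.natDegree = r → h ∣ f.map φ → (g.map φ).eval (h.eval (φ l)) = 0 := by
  set k := FractionRing A
  let E := AlgebraicClosure k
  set i := algebraMap A k
  have hi : Function.Injective i := IsFractionRing.injective A k
  set f₁ := f.map i with hf₁
  have hf₁m : f₁.Monic := hf.map _
  set s := (f₁.map (algebraMap k E)).roots with hs
  have hsplits : (f₁.map (algebraMap k E)).Splits := IsAlgClosed.splits _
  have hsn : s.Nodup := nodup_roots (hsep.map (f := algebraMap k E))
  have hfs : f₁.map (algebraMap k E) = (s.map fun x => X - C x).prod :=
    hsplits.eq_prod_roots_of_monic (hf₁m.map _)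
  obtain ⟨l, hnodup, hl⟩ := exists_generic_shift i hi hirr hsn hfs h0
    (by rwa [hf₁, hf.natDegree_map])
  obtain ⟨g, hgm, hg⟩ := exists_subset_product_poly hf r l
  have hgE := hg E ((algebraMap k E).comp i) s (by rw [← Polynomial.map_map]; exact hfs)
  have hgE' : g.map ((algebraMap k E).comp i) = (((s.powersetCard r).map fun T =>
      (T.map (algebraMap k E (i l) - ·)).prod).map fun x => X - C x).prod := by
    rw [hgE, Multiset.map_map]
    rfl
  have hgroots := congrArg roots hgE'
  rw [roots_multiset_prod_X_sub_C] at hgroots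
  have hgsep : (g.map i).Separable := by
    rw [← separable_map (algebraMap k E), Polynomial.map_map,
      ← nodup_roots_iff_of_splits (hgm.map _).ne_zero (IsAlgClosed.splits _), hgroots]
    exact hnodup
  obtain ⟨α, β, Δ, hab, hΔ⟩ := exists_certificate_of_separable hgsep
  refine ⟨l, g, α, β, Δ, hgm, ?_, hab, hΔ, ?_⟩
  · intro x hx
    have hroot : ((algebraMap k E).comp i) x ∈ (g.map ((algebraMap k E).comp i)).roots := by
      rw [mem_roots (hgm.map _).ne_zero, IsRoot, eval_map_apply, hx, map_zero]
    rw [hgroots] at hroot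
    obtain ⟨T, hT, hTx⟩ := Multiset.mem_map.1 hroot
    exact hl T hT _ hTx
  · intro B _ _ φ h hm hd hdvd
    let L := AlgebraicClosure (FractionRing B)
    let j : B →+* L := (algebraMap (FractionRing B) L).comp (algebraMap B (FractionRing B))
    have hj : Function.Injective j :=
      (algebraMap (FractionRing B) L).injective.comp (IsFractionRing.injective B (FractionRing B))
    have hfL : f.map (j.comp φ) = ((f.map (j.comp φ)).roots.map fun x => X - C x).prod :=
      (IsAlgClosed.splits _).eq_prod_roots_of_monic (hf.map _)
    have hgL := hg L (j.comp φ) _ hfL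
    have hhL : (h.map j).Splits := IsAlgClosed.splits _
    have hT : (h.map j).roots ∈ (f.map (j.comp φ)).roots.powersetCard r := by
      rw [Multiset.mem_powersetCard, ← hhL.natDegree_eq_card_roots, hm.natDegree_map, hd]
      refine ⟨roots.le_of_dvd (hf.map _).ne_zero ?_, rfl⟩
      rw [← Polynomial.map_map φ j]
      exact Polynomial.map_dvd j hdvd
    apply hj
    rw [map_zero, ← eval_map_apply, Polynomial.map_map, ← eval_map_apply, hgL, eval_multiset_prod,
      Multiset.map_map]
    apply Multiset.prod_eq_zero
    refine Multiset.mem_map.2 ⟨_, hT, ?_⟩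
    conv_lhs => rw [Function.comp_apply, hhL.eq_prod_roots_of_monic (hm.map _)]
    simp [eval_multiset_prod, Multiset.map_map]

end Resolvent

section Separable

universe u
variable {F : Type u} [Field F] [Fintype F] {n : ℕ}

theorem sparse_not_irreducible_of_separable {f : (MvPolynomial (Fin n) F[X])[X]} (hf : f.Monic)
    (hirr : Irreducible (f.map (algebraMap _ (FractionRing (MvPolynomial (Fin n) F[X])))))
    (hsep : (f.map (algebraMap _ (FractionRing (MvPolynomial (Fin n) F[X])))).Separable) :
    Sparse {t | ¬ Irreducible (f.map (MvPolynomial.eval t))} := by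
  have hdeg : f.natDegree ≠ 0 := by
    rw [← hf.natDegree_map (algebraMap _ (FractionRing (MvPolynomial (Fin n) F[X])))]
    exact hirr.natDegree_pos.ne'
  have hinf : Infinite (MvPolynomial (Fin n) F[X]) :=
    .of_injective _ (MvPolynomial.C_injective (Fin n) F[X])
  refine Sparse.mono (Sparse.biUnion (Finset.Ioc 0 (f.natDegree / 2)) (S := fun r =>
    {t | ∃ h : F[X][X], h.Monic ∧ h.natDegree = r ∧ h ∣ f.map (MvPolynomial.eval t)}) ?_) ?_
  · intro r hr
    rw [Finset.mem_Ioc] at hr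
    obtain ⟨l, g, α, β, Δ, hg, hroot, hab, hΔ, h⟩ :=
      exists_resolvent hf hirr hsep hr.1.ne' (by omega)
    refine (sparse_exists_root hg hroot hab hΔ).mono ?_
    rintro t ⟨P, hP, hPr, hdvd⟩
    exact ⟨_, h F[X] (MvPolynomial.eval t) P hP hPr hdvd⟩
  · intro t ht
    have h1 : f.map (MvPolynomial.eval t) ≠ 1 := by
      intro h
      apply hdeg
      rw [← hf.natDegree_map (MvPolynomial.eval t), h, natDegree_one]
    rw [Set.mem_ofPred_eq, (hf.map _).irreducible_iff_lt_natDegree_lt h1] at ht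
    push Not at ht
    obtain ⟨P, hP, hPr, hdvd⟩ := ht
    rw [hf.natDegree_map] at hPr
    exact Set.mem_biUnion hPr ⟨P, hP, rfl, hdvd⟩

end Separable

section Inseparable

theorem irreducible_expand_of_coeff_ne_pow {k : Type*} [Field k] (p : ℕ) [Fact p.Prime] [CharP k p]
    {g : k[X]} (hg : Irreducible g) (hm : g.Monic) (hc : ∃ i, ∀ b, g.coeff i ≠ b ^ p) :
    Irreducible (expand k p g) := by
  have hp : p.Prime := Fact.out
  have hpos : 0 < (expand k p g).natDegree := by
    rw [natDegree_expand]
    exact Nat.mul_pos hg.natDegree_pos hp.pos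
  have hPm : (expand k p g).Monic := (monic_expand_iff hp.pos).2 hm
  obtain ⟨h, hhm, hh, hdvd⟩ := exists_monic_irreducible_factor (expand k p g)
    fun hu => hpos.ne' (natDegree_eq_zero_of_isUnit hu)
  have hexp : expand k p (h.map (frobenius k p)) = h ^ p := by
    rw [← map_expand, map_frobenius_expand]
  have hgH : g ∣ h.map (frobenius k p) := by
    refine (hg.isCoprime_or_dvd _).resolve_left fun hcop => hh.not_isUnit ?_
    refine IsCoprime.isUnit_of_dvd' ((isCoprime_expand hp.ne_zero).2 hcop) hdvd ?_
    rw [hexp]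
    exact dvd_pow_self h hp.ne_zero
  have hPd : expand k p g ∣ h ^ p := by
    obtain ⟨w, hw⟩ := hgH
    rw [← hexp, hw, map_mul]
    exact dvd_mul_right _ _
  obtain ⟨j, hj, hass⟩ := (dvd_prime_pow hh.prime p).1 hPd
  have hPj : expand k p g = h ^ j := eq_of_monic_of_associated hPm (hhm.pow j) hass
  have hj0 : j ≠ 0 := by
    rintro rfl
    rw [hPj, pow_zero, natDegree_one] at hpos
    exact hpos.false
  rcases eq_or_ne j 1 with rfl | hj1
  · rwa [hPj, pow_one]
  rcases hj.eq_or_lt with hjp | hjp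
  · rw [hjp, ← hexp, expand_inj hp.pos] at hPj
    obtain ⟨i, hi⟩ := hc
    refine absurd ?_ (hi (h.coeff i))
    rw [hPj, coeff_map, frobenius_def]
  · have hder : derivative h = 0 := by
      have h0 : derivative (expand k p g) = 0 := by
        rw [derivative_expand]
        simp
      rw [hPj, derivative_pow] at h0
      have hjk : (j : k) ≠ 0 := by
        rw [Ne, CharP.cast_eq_zero_iff k p]
        exact fun hd => hj0 (Nat.eq_zero_of_dvd_of_lt hd hjp)
      exact (mul_eq_zero.1 h0).resolve_left
        (mul_ne_zero (C_ne_zero.2 hjk) (pow_ne_zero _ hh.ne_zero))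
    have hh1 := expand_contract p hder hp.ne_zero
    rw [← hh1, ← map_pow, expand_inj hp.pos] at hPj
    rw [hPj] at hg
    exact absurd hg (not_irreducible_pow hj1)

theorem irreducible_expand_pow_of_coeff_ne_pow {k : Type*} [Field k] (p : ℕ) [Fact p.Prime]
    [CharP k p] {g : k[X]} (hg : Irreducible g) (hm : g.Monic) {i : ℕ}
    (hc : ∀ b, g.coeff i ≠ b ^ p) (m : ℕ) : Irreducible (expand k (p ^ m) g) := by
  have hp : 0 < p := (Fact.out : p.Prime).pos
  induction m with
  | zero => simpa using hg
  | succ m ih =>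
    rw [pow_succ', expand_mul]
    refine irreducible_expand_of_coeff_ne_pow p ih ((monic_expand_iff (pow_pos hp m)).2 hm)
      ⟨i * p ^ m, ?_⟩
    rwa [coeff_expand_mul (pow_pos hp m)]

universe u
variable {F : Type u} [Field F] [Fintype F] {n : ℕ}

omit [Fintype F] in
theorem irreducible_expand_pow_of_derivative_ne_zero (p : ℕ) [Fact p.Prime] [CharP F p]
    {g : F[X][X]} (hg : Irreducible g) (hm : g.Monic) {i : ℕ} (hc : derivative (g.coeff i) ≠ 0)
    (m : ℕ) : Irreducible (expand F[X] (p ^ m) g) := by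
  have hp : p.Prime := Fact.out
  have : CharP (FractionRing F[X]) p :=
    charP_of_injective_algebraMap (IsFractionRing.injective F[X] (FractionRing F[X])) p
  refine Monic.irreducible_of_irreducible_map (algebraMap F[X] (FractionRing F[X])) _
    ((monic_expand_iff (pow_pos hp.pos m)).2 hm) ?_
  rw [map_expand]
  refine irreducible_expand_pow_of_coeff_ne_pow p
    (hm.irreducible_iff_irreducible_map_fraction_map.1 hg) (hm.map _) (i := i) (fun b hb => ?_) m
  rw [coeff_map] at hb
  obtain ⟨c, rfl⟩ := IsIntegrallyClosed.exists_algebraMap_eq_of_isIntegral_pow (R := F[X]) hp.pos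
    (x := b) (hb ▸ isIntegral_algebraMap)
  rw [← map_pow, (IsFractionRing.injective F[X] (FractionRing F[X])).eq_iff] at hb
  apply hc
  simp [hb, derivative_pow]

theorem sparse_not_irreducible {f : (MvPolynomial (Fin n) F[X])[X]} (hf : f.Monic)
    (hirr : Irreducible (f.map (algebraMap _ (FractionRing (MvPolynomial (Fin n) F[X]))))) :
    Sparse {t | ¬ Irreducible (f.map (MvPolynomial.eval t))} := by
  set A := MvPolynomial (Fin n) F[X] with hA
  set i := algebraMap A (FractionRing A) with hi
  have hinj : Function.Injective i := IsFractionRing.injective A (FractionRing A)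
  obtain ⟨p, hF⟩ := CharP.exists F
  have : Fact p.Prime := ⟨CharP.char_is_prime F p⟩
  have hp : p.Prime := Fact.out
  have : CharP (FractionRing A) p := charP_of_injective_algebraMap hinj p
  obtain ⟨m, g, hsep, hgf⟩ := exists_separable_of_irreducible p hirr hp.ne_zero
  have hpm : p ^ m ≠ 0 := pow_ne_zero m hp.ne_zero
  set G := contract (p ^ m) f with hG
  have hGg : G.map i = g := by rw [hG, map_contract hpm, ← hgf, contract_expand _ hpm]
  have hGf : expand A (p ^ m) G = f := by
    apply map_injective i hinj
    rw [map_expand, hGg, hgf]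
  have hGm : G.Monic := by
    rwa [← hGf, monic_expand_iff (Nat.pos_of_ne_zero hpm)] at hf
  have hGirr : Irreducible (G.map i) := by
    rw [← hgf, ← hGg] at hirr
    exact of_irreducible_expand hpm hirr
  have hGs := sparse_not_irreducible_of_separable hGm hGirr (hGg ▸ hsep)
  rcases m with _ | m
  · rw [pow_zero, expand_one] at hGf
    rwa [hGf] at hGs
  have hc : ∃ j, ∀ b, G.coeff j ≠ b ^ p := by
    by_contra! hc
    obtain ⟨b, hb⟩ := exists_pow_eq_expand p hc
    rw [← hGf, pow_succ, expand_mul, hb, map_pow, Polynomial.map_pow] at hirr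
    exact not_irreducible_pow hp.ne_one hirr
  obtain ⟨j, hj⟩ := hc
  refine (hGs.union (sparse_derivative_eq_zero p hj)).mono fun t ht => ?_
  by_contra hn
  rw [Set.mem_union, not_or] at hn
  simp only [Set.mem_ofPred_eq, not_not] at hn ht
  apply ht
  rw [← hGf, map_expand]
  exact irreducible_expand_pow_of_derivative_ne_zero p hn.1 (hGm.map _) (i := j)
    (by rw [coeff_map]; exact hn.2) _

end Inseparable

section Assembly

theorem irreducible_scaleRoots {k : Type*} [Field k] {p : k[X]} {a : k} (ha : a ≠ 0) :
    Irreducible (p.scaleRoots a) ↔ Irreducible p := by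
  let _ : Invertible a⁻¹ := invertibleOfNonzero (inv_ne_zero ha)
  have h : p.scaleRoots a = C (a ^ p.natDegree) * algEquivCMulXAddC a⁻¹ 0 p := by
    rw [algEquivCMulXAddC_apply, C_0, add_zero, ← comp_eq_aeval]
    ext i
    rw [coeff_scaleRoots, coeff_C_mul, comp_C_mul_X_coeff]
    rcases le_or_gt i p.natDegree with hi | hi
    · rw [pow_sub₀ a ha hi, inv_pow]
      ring
    · rw [coeff_eq_zero_of_natDegree_lt hi]
      simp
  rw [h, irreducible_isUnit_mul (isUnit_C.2 (pow_ne_zero _ ha).isUnit), MulEquiv.irreducible_iff]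

theorem irreducible_map_integralNormalization {A k : Type*} [CommRing A] [Field k] (φ : A →+* k)
    {f : A[X]} (hf : φ f.leadingCoeff ≠ 0) :
    Irreducible (f.integralNormalization.map φ) ↔ Irreducible (f.map φ) := by
  have h := congrArg (Polynomial.map φ) (leadingCoeff_smul_integralNormalization f)
  rw [map_scaleRoots _ _ _ hf, smul_eq_C_mul, Polynomial.map_mul, map_C] at h
  rw [← irreducible_scaleRoots (p := f.map φ) hf, ← h,
    irreducible_isUnit_mul (isUnit_C.2 hf.isUnit)]

theorem exists_clear_denominators {A k : Type*} [CommRing A] [IsDomain A] [Field k] [Algebra A k]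
    [IsFractionRing A k] {n : ℕ} (f : (MvPolynomial (Fin n) k)[X]) :
    ∃ (c : A) (g : (MvPolynomial (Fin n) A)[X]), c ≠ 0 ∧
      g.map (MvPolynomial.map (algebraMap A k)) = C (MvPolynomial.C (algebraMap A k c)) * f := by
  let _ : Algebra (MvPolynomial (Fin n) A) (MvPolynomial (Fin n) k) :=
    MvPolynomial.algebraMvPolynomial
  have := MvPolynomial.isLocalization (σ := Fin n) (nonZeroDivisors A) k
  obtain ⟨b, ⟨c, hc, rfl⟩, h⟩ := IsLocalization.integerNormalization_spec
    (R := MvPolynomial (Fin n) A) (Submonoid.map MvPolynomial.C (nonZeroDivisors A)) f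
  refine ⟨c, _, nonZeroDivisors.ne_zero hc, h.trans ?_⟩
  rw [Algebra.smul_def, Polynomial.algebraMap_apply, MvPolynomial.algebraMap_def,
    MvPolynomial.map_C]

universe u
variable {F : Type u} [Field F] [Fintype F] {n : ℕ}

theorem sparse_not_irreducible_eval {f : (MvPolynomial (Fin n) (RatFunc F))[X]} (hf : Irreducible f)
    (hdeg : f.natDegree ≠ 0) :
    Sparse {t | ¬ Irreducible
      (f.map (MvPolynomial.eval fun i => algebraMap F[X] (RatFunc F) (t i)))} := by
  obtain ⟨c, g, hc, hg⟩ := exists_clear_denominators (A := F[X]) f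
  set ι : MvPolynomial (Fin n) F[X] →+* MvPolynomial (Fin n) (RatFunc F) :=
    MvPolynomial.map (algebraMap F[X] (RatFunc F)) with hι
  have hιinj : Function.Injective ι :=
    MvPolynomial.map_injective _ (IsFractionRing.injective F[X] (RatFunc F))
  have hcK : algebraMap F[X] (RatFunc F) c ≠ 0 := by
    rwa [Ne, FaithfulSMul.algebraMap_eq_zero_iff]
  have hg0 : g ≠ 0 := by
    rintro rfl
    rw [Polynomial.map_zero, eq_comm, mul_eq_zero, C_eq_zero, MvPolynomial.C_eq_zero] at hg
    exact hg.elim hcK hf.ne_zero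
  set E := FractionRing (MvPolynomial (Fin n) (RatFunc F)) with hE
  set κ := algebraMap (MvPolynomial (Fin n) (RatFunc F)) E with hκ
  have hκinj : Function.Injective κ := IsFractionRing.injective _ _
  have hirrE : Irreducible (g.map (κ.comp ι)) := by
    rw [← Polynomial.map_map, hg, Polynomial.map_mul, map_C, irreducible_isUnit_mul]
    · exact (hf.isPrimitive hdeg).irreducible_iff_irreducible_map_fraction_map.1 hf
    · rw [isUnit_C]
      exact ((isUnit_iff_ne_zero.2 hcK).map MvPolynomial.C).map κ
  have hm : g.integralNormalization.Monic := monic_integralNormalization hg0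
  have hirr : Irreducible g.integralNormalization := by
    refine hm.irreducible_of_irreducible_map (κ.comp ι) _ ?_
    rwa [irreducible_map_integralNormalization]
    rw [RingHom.comp_apply, Ne, map_eq_zero_iff κ hκinj, map_eq_zero_iff ι hιinj]
    exact leadingCoeff_ne_zero.2 hg0
  have hs := sparse_not_irreducible hm (hm.irreducible_iff_irreducible_map_fraction_map.1 hirr)
  refine (hs.union (sparse_eval_eq_zero (leadingCoeff_ne_zero.2 hg0))).mono fun t ht => ?_
  by_contra hn
  rw [Set.mem_union, not_or] at hn
  simp only [Set.mem_ofPred_eq, not_not] at hn ht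
  apply ht
  have h1 := (hm.map (MvPolynomial.eval t)).irreducible_iff_irreducible_map_fraction_map
    (K := RatFunc F) |>.1 hn.1
  rw [Polynomial.map_map, irreducible_map_integralNormalization] at h1
  · have hcomp : (algebraMap F[X] (RatFunc F)).comp (MvPolynomial.eval t)
        = (MvPolynomial.eval fun i => algebraMap F[X] (RatFunc F) (t i)).comp ι := by
      refine MvPolynomial.ringHom_ext (fun a => ?_) fun i => ?_ <;> simp [ι]
    rw [hcomp, ← Polynomial.map_map, hg, Polynomial.map_mul, map_C, MvPolynomial.eval_C,
      irreducible_isUnit_mul (isUnit_C.2 (isUnit_iff_ne_zero.2 hcK))] at h1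
    exact h1
  · rw [RingHom.comp_apply, Ne, FaithfulSMul.algebraMap_eq_zero_iff]
    exact hn.2

theorem Sparse.exists_abs_ncard_div_sub_one_le {S : Set (Fin n → F[X])}
    (h : Sparse {t | t ∉ S}) : ∃ C : ℝ, ∀ d : ℕ, 1 ≤ d →
      |({t : Fin n → F[X] | (∀ i, (t i).Monic ∧ (t i).natDegree = d) ∧ t ∈ S}.ncard : ℝ)
          / (Fintype.card F : ℝ) ^ (d * n) - 1|
        ≤ C * d * (Fintype.card F : ℝ) ^ (-(d : ℝ) / 2) := by
  classical
  obtain ⟨K, hK⟩ := h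
  set q := Fintype.card F with hq
  have hq1 : 1 < q := one_lt_card
  refine ⟨K * q, fun d hd => ?_⟩
  let V : Finset (Fin n → F[X]) := Fintype.piFinset fun _ => monics F d
  have hV (t : Fin n → F[X]) : t ∈ V ↔ ∀ i, (t i).Monic ∧ (t i).natDegree = d := by
    simp only [V, Fintype.mem_piFinset, mem_monics]
  have hVcard : V.card = q ^ (d * n) := by
    rw [Fintype.card_piFinset_const, card_monics, ← pow_mul]
  have hgood : {t : Fin n → F[X] | (∀ i, (t i).Monic ∧ (t i).natDegree = d) ∧ t ∈ S}
      = ↑(V.filter (· ∈ S)) := by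
    ext t
    simp [hV]
  have hbad := hK d hd (V.filter (· ∉ S)) fun t ht => by
    rw [Finset.mem_filter] at ht
    exact ⟨ht.2, Fintype.mem_piFinset.1 ht.1⟩
  have hsum := Finset.card_filter_add_card_filter_not (s := V) (· ∈ S)
  rw [hgood, Set.ncard_coe_finset]
  set a := (V.filter (· ∈ S)).card
  set b := (V.filter (· ∉ S)).card
  have hq0 : (0 : ℝ) < q := by positivity
  have hqn : (0 : ℝ) < (q : ℝ) ^ (d * n) := by positivity
  have hab : (a : ℝ) + b = (q : ℝ) ^ (d * n) := by
    rw [hVcard] at hsum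
    exact_mod_cast hsum
  have hbad' : (b : ℝ) * (q : ℝ) ^ (d / 2) ≤ K * d * (q : ℝ) ^ (d * n) := by
    exact_mod_cast hbad
  have hdiv : (a : ℝ) / (q : ℝ) ^ (d * n) - 1 = -(b / (q : ℝ) ^ (d * n)) := by
    rw [← hab] at hqn ⊢
    field_simp
    ring
  rw [hdiv, abs_neg, abs_of_nonneg (by positivity)]
  have hpow : (1 : ℝ) ≤ q * (q : ℝ) ^ (-(d : ℝ) / 2) * (q : ℝ) ^ (d / 2) := by
    have h : (q : ℝ) ^ (1 + -(d : ℝ) / 2 + (d / 2 : ℕ))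
        = q * (q : ℝ) ^ (-(d : ℝ) / 2) * (q : ℝ) ^ (d / 2) := by
      rw [Real.rpow_add hq0, Real.rpow_add hq0, Real.rpow_one, Real.rpow_natCast]
    rw [← h]
    refine Real.one_le_rpow (by exact_mod_cast hq1.le) ?_
    have : (d : ℝ) ≤ 2 * ((d / 2 : ℕ) : ℝ) + 1 := by
      exact_mod_cast (by omega : d ≤ 2 * (d / 2) + 1)
    linarith
  rw [div_le_iff₀ hqn]
  calc (b : ℝ) ≤ b * (q * (q : ℝ) ^ (-(d : ℝ) / 2) * (q : ℝ) ^ (d / 2)) :=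
        le_mul_of_one_le_right (by positivity) hpow
    _ = b * (q : ℝ) ^ (d / 2) * (q * (q : ℝ) ^ (-(d : ℝ) / 2)) := by ring
    _ ≤ K * d * (q : ℝ) ^ (d * n) * (q * (q : ℝ) ^ (-(d : ℝ) / 2)) := by gcongr
    _ = _ := by ring

end Assembly

end FunctionFieldHilbert

/-- Theorem 1.1 of Bary-Soroker–Entin, quantitative Hilbert irreducibility
over `K = 𝔽_q(u)`.  Let `f(T₁,…,Tₙ,X) ∈ K[T₁,…,Tₙ,X]` be an irreducible polynomial of
positive degree in `X`.  Let `H_f(d)` be the number of `n`-tuples `(t₁,…,tₙ)` of monic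
polynomials of degree `d` in `𝔽_q[u]` for which `f(t₁,…,tₙ,X) ∈ K[X]` is irreducible.  Then
there is a constant `C`, depending only on `f` and `q`, such that
`|H_f(d)/q^{dn} − 1| ≤ C · d · q^{−d/2}` for all `d ≥ 1`.

Here `K[T₁,…,Tₙ,X]` is formalized as `Polynomial (MvPolynomial (Fin n) (RatFunc Fq))`
(polynomials in `X` with coefficients in `K[T₁,…,Tₙ]`), and `f(t₁,…,tₙ,X)` is obtained by
evaluating each coefficient at `Tᵢ ↦ tᵢ ∈ K`. -/
theorem hilbert_irreducibility_count
    (Fq : Type) [Field Fq] [Fintype Fq] (q : ℕ) (hq : Fintype.card Fq = q)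
    (n : ℕ) (f : Polynomial (MvPolynomial (Fin n) (RatFunc Fq)))
    (hirr : Irreducible f) (hdeg : 0 < f.natDegree) :
    ∃ C : ℝ, ∀ d : ℕ, 1 ≤ d →
      |({t : Fin n → Polynomial Fq |
            (∀ i, (t i).Monic ∧ (t i).natDegree = d) ∧
              Irreducible (f.map (MvPolynomial.eval
                (fun i => algebraMap (Polynomial Fq) (RatFunc Fq) (t i))))}.ncard : ℝ)
          / (q : ℝ) ^ (d * n) - 1|
        ≤ C * d * (q : ℝ) ^ (-(d : ℝ) / 2) := by
  subst hq
  exact FunctionFieldHilbert.Sparse.exists_abs_ncard_div_sub_one_le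
    (FunctionFieldHilbert.sparse_not_irreducible_eval hirr hdeg.ne')
    (S := {t | Irreducible (f.map (MvPolynomial.eval
      (fun i => algebraMap (Polynomial Fq) (RatFunc Fq) (t i))))})
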